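/- arXiv:1910.13378 — 2 statements merged into one kernel-verified Lean document; each statement's English description precedes it below -/
import Mathlib

section
/- Distribution of the first part under the g-measure: for q_1,…,q_c ∈ (0,1) and every positive integer a, the g-measure of the set {π ∈ PP(∞,b,c) : λ_1 ≤ a}, where λ = sh(π), equals Z_{b,c}^{−1} s_{(a^b)}(1^b, q_1,…,q_c). Equivalently, ∑_{π ∈ PP(a,b,c)} ∏_{(i,j)∈Des(π)} q_{π_{ij}} = s_{(a^b)}(1^b, q_1,…,q_c). -/
open scoped BigOperators

/-- A plane partition: a matrix of naturals (0-indexed) with weakly decreasing rows and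
columns and finitely many nonzero entries. -/
structure PlanePartition where
  entry : ℕ → ℕ → ℕ
  row_decr : ∀ i j, entry i (j + 1) ≤ entry i j
  col_decr : ∀ i j, entry (i + 1) j ≤ entry i j
  finite_support : {p : ℕ × ℕ | entry p.1 p.2 ≠ 0}.Finite

namespace PlanePartition

/-- `π` has at most `b` (nonzero) rows. -/
def rowsLE (π : PlanePartition) (b : ℕ) : Prop := ∀ i j, b ≤ i → π.entry i j = 0

/-- `π` has at most `a` (nonzero) columns. -/
def colsLE (π : PlanePartition) (a : ℕ) : Prop := ∀ i j, a ≤ j → π.entry i j = 0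

/-- all entries of `π` are at most `c`. -/
def entriesLE (π : PlanePartition) (c : ℕ) : Prop := ∀ i j, π.entry i j ≤ c

/-- the number of columns of `π` containing the entry `ℓ`. -/
noncomputable def cCol (π : PlanePartition) (ℓ : ℕ) : ℕ :=
  {j | ∃ i, π.entry i j = ℓ}.ncard

/-- the length of the `i`-th row of `π` (0-indexed); this is the `(i+1)`-st part of
the shape of `π`. -/
noncomputable def rowLen (π : PlanePartition) (i : ℕ) : ℕ :=
  {j | 0 < π.entry i j}.ncard

/-- `d_{iℓ} = #{j : π_{ij} = ℓ > π_{i+1,j}}`; the row index `i` is 0-indexed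
while `ℓ` denotes the actual value. -/
noncomputable def phi (π : PlanePartition) (i ℓ : ℕ) : ℕ :=
  {j | π.entry i j = ℓ ∧ π.entry (i + 1) j < ℓ}.ncard

/-- `Φ(π)` as a 0-indexed matrix: entry `(i, l)` counts `j` with `π_{ij} = l+1 > π_{i+1,j}`. -/
noncomputable def phiMatrix (π : PlanePartition) : ℕ → ℕ → ℕ :=
  fun i l => π.phi i (l + 1)

/-- `π` has shape `μ`. -/
def hasShape (π : PlanePartition) (μ : YoungDiagram) : Prop :=
  ∀ i j, 0 < π.entry i j ↔ (i, j) ∈ μ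

/-- the descent set of `π` (0-indexed positions). -/
def des (π : PlanePartition) : Set (ℕ × ℕ) :=
  {p | π.entry (p.1 + 1) p.2 < π.entry p.1 p.2}

end PlanePartition

/-- the set of plane partitions with at most `a` columns, at most `b` rows
and entries at most `c`. -/
def PP (a b c : ℕ) : Set PlanePartition :=
  {π | π.colsLE a ∧ π.rowsLE b ∧ π.entriesLE c}

/-- `PP(∞, b, c)`: plane partitions with at most `b` rows and entries at most `c`. -/
def PPinf (b c : ℕ) : Set PlanePartition :=
  {π | π.rowsLE b ∧ π.entriesLE c}

/-- a monotone lattice path (as a list of points) from `s` to `t`. -/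
def IsMonPath (L : List (ℕ × ℕ)) (s t : ℕ × ℕ) : Prop :=
  L.head? = some s ∧ L.getLast? = some t ∧
    L.Chain' fun p q => q = (p.1 + 1, p.2) ∨ q = (p.1, p.2 + 1)

/-- the last passage time: the maximal weight of a monotone path from `s` to `t`
in the matrix `d`. -/
noncomputable def lastPassage (d : ℕ → ℕ → ℕ) (s t : ℕ × ℕ) : ℕ :=
  sSup {n | ∃ L, IsMonPath L s t ∧ n = (L.map fun p => d p.1 p.2).sum}

/-- `b×c` matrices of naturals (as functions vanishing off `[0,b) × [0,c)`) whose
last passage time `G(b,c)` is at most `a`. -/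
def BM (a b c : ℕ) : Set (ℕ → ℕ → ℕ) :=
  {d | (∀ i j, b ≤ i → d i j = 0) ∧ (∀ i j, c ≤ j → d i j = 0) ∧
    lastPassage d (0, 0) (b - 1, c - 1) ≤ a}

/-- the rectangular Young diagram of the partition `(a^b)` (with `b` rows of length `a`). -/
def rectDiagram (a b : ℕ) : YoungDiagram where
  cells := Finset.range b ×ˢ Finset.range a
  isLowerSet := by
    intro p q hle hp
    simp only [Finset.coe_product, Set.mem_prod, Finset.mem_coe, Finset.mem_range] at hp ⊢
    exact ⟨lt_of_le_of_lt hle.1 hp.1, lt_of_le_of_lt hle.2 hp.2⟩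

/-- the variables `(1^b, x_1, x_2, …)`: the first `b` variables are specialized to `1`. -/
def oneExtend (b : ℕ) (x : ℕ → ℝ) : ℕ → ℝ :=
  fun i => if i < b then 1 else x (i - b)

/-- the Schur polynomial `s_μ(x_1, …, x_N)` evaluated at real arguments;
variables are 0-indexed (`x ℓ` is the variable `x_{ℓ+1}`), as are tableau entries. -/
noncomputable def schur (μ : YoungDiagram) (N : ℕ) (x : ℕ → ℝ) : ℝ :=
  ∑ᶠ T ∈ {T : SemistandardYoungTableau μ | ∀ i j, (i, j) ∈ μ → T i j < N},
    ∏ p ∈ μ.cells, x (T p.1 p.2)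

/-- the dual symmetric Grothendieck polynomial `g_μ(x_1, …, x_n)` evaluated at real
arguments; variables are 0-indexed (`x ℓ` is the variable `x_{ℓ+1}`). -/
noncomputable def grothG (μ : YoungDiagram) (n : ℕ) (x : ℕ → ℝ) : ℝ :=
  ∑ᶠ π ∈ {π : PlanePartition | π.hasShape μ ∧ π.entriesLE n},
    ∏ ℓ ∈ Finset.range n, x ℓ ^ π.cCol (ℓ + 1)

/-- the elementary symmetric polynomial `e_m(x_1, …, x_n)` evaluated at real arguments. -/
noncomputable def esym (n : ℕ) (x : ℕ → ℝ) (m : ℕ) : ℝ :=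
  ∑ S ∈ (Finset.range n).powersetCard m, ∏ i ∈ S, x i

/-- `e_m` for an integer index `m`, with `e_m = 0` for `m < 0`. -/
noncomputable def esymZ (n : ℕ) (x : ℕ → ℝ) (m : ℤ) : ℝ :=
  if 0 ≤ m then esym n x m.toNat else 0

/-- the weight `∏_{(i,j) ∈ Des(π)} q_{π_{ij}}`; the parameters are 0-indexed
(`q ℓ` is the parameter `q_{ℓ+1}`). -/
noncomputable def desWeight (π : PlanePartition) (q : ℕ → ℝ) : ℝ :=
  ∏ᶠ p ∈ π.des, q (π.entry p.1 p.2 - 1)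

/-- the probability of a configuration `w` of a `b×c` matrix of i.i.d. Geom(q) entries,
where `P(entry = k) = (1-q) qᵏ`. -/
noncomputable def geomWeight (q : ℝ) (b c : ℕ) (w : Fin b × Fin c → ℕ) : ℝ :=
  ∏ p : Fin b × Fin c, ((1 - q) * q ^ w p)

/-- extend a `b×c` matrix to an `ℕ × ℕ`-indexed matrix by zero. -/
def matExt {b c : ℕ} (w : Fin b × Fin c → ℕ) : ℕ → ℕ → ℕ :=
  fun i j => if h : i < b ∧ j < c then w (⟨i, h.1⟩, ⟨j, h.2⟩) else 0


namespace GM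

open Classical in
/-- Sum over all paths of length `n` from `x` to a given endpoint, by transfer operators. -/
noncomputable def K {V : Type} [Fintype V] (w : ℕ → V → V → ℝ) (x : V) : ℕ → V → ℝ
  | 0, y => if y = x then 1 else 0
  | n + 1, y => ∑ z, K w x n z * w n z y

open Classical in
theorem K_path {V : Type} [Fintype V] (w : ℕ → V → V → ℝ) (x : V) (n : ℕ) :
    ∀ g : V → ℝ, ∑ y, K w x n y * g y =
      ∑ f : Fin (n + 1) → V, (if f 0 = x then
        (∏ i : Fin n, w i (f i.castSucc) (f i.succ)) * g (f (Fin.last n)) else 0) := by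
  induction n with
  | zero =>
    intro g
    simp only [K]
    symm
    apply Fintype.sum_equiv (Equiv.funUnique (Fin 1) V)
    intro f
    simp [Equiv.funUnique]
  | succ n ih =>
    intro g
    have h1 : ∑ y, K w x (n + 1) y * g y = ∑ z, K w x n z * (∑ y, w n z y * g y) := by
      simp only [K, Finset.sum_mul, Finset.mul_sum]
      rw [Finset.sum_comm]
      simp only [mul_assoc]
    rw [h1, ih]
    rw [← (Fin.snocEquiv (fun _ : Fin (n + 2) => V)).sum_comp, Fintype.sum_prod_type, Finset.sum_comm]
    apply Finset.sum_congr rfl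
    intro f _
    have h0 : ∀ y : V, Fin.snoc (α := fun _ => V) f y 0 = f 0 := fun y => by
      have := Fin.snoc_castSucc (α := fun _ => V) y f 0
      exact this
    simp only [Fin.snocEquiv, Equiv.coe_fn_mk, h0]
    by_cases hx : f 0 = x
    · simp only [hx, if_true, Finset.mul_sum]
      apply Finset.sum_congr rfl
      intro y _
      rw [Fin.prod_univ_castSucc]
      simp only [Fin.snoc_castSucc, Fin.succ_castSucc, Fin.succ_last, Fin.snoc_last,
        Fin.val_castSucc, Fin.val_last]
      ring
    · simp [hx]

open Classical in
theorem K_path' {V : Type} [Fintype V] (w : ℕ → V → V → ℝ) (x : V) (n : ℕ) (y : V) :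
    K w x n y =
      ∑ f : Fin (n + 1) → V, (if f 0 = x ∧ f (Fin.last n) = y then
        (∏ i : Fin n, w i (f i.castSucc) (f i.succ)) else 0) := by
  have := K_path w x n (fun z => if z = y then 1 else 0)
  simp only [mul_ite, mul_one, mul_zero, Finset.sum_ite_eq', Finset.mem_univ, if_true] at this
  rw [this]
  apply Finset.sum_congr rfl
  intro f _
  by_cases h1 : f 0 = x <;> by_cases h2 : f (Fin.last n) = y <;> simp [h1, h2]

theorem K_add {V : Type} [Fintype V] (w : ℕ → V → V → ℝ) (x : V) (m n : ℕ) : ∀ z,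
    K w x (m + n) z = ∑ y, K w x m y * K (fun j => w (m + j)) y n z := by
  induction n with
  | zero => intro z; classical simp [K, Finset.sum_ite_eq]
  | succ n ih =>
    intro z
    rw [← add_assoc]
    simp only [K, ih, Finset.mul_sum, Finset.sum_mul]
    rw [Finset.sum_comm]
    simp only [mul_assoc]

/-- Reversal of paths, composed with an involution. -/
theorem K_rev {V : Type} [Fintype V] (w w' : ℕ → V → V → ℝ) (σ : V → V)
    (hσ : Function.Involutive σ) (x y : V) (n : ℕ)
    (hw : ∀ j < n, ∀ u v, w' j u v = w (n - 1 - j) (σ v) (σ u)) :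
    K w x n y = K w' (σ y) n (σ x) := by
  classical
  rw [K_path', K_path']
  let e : (Fin (n + 1) → V) ≃ (Fin (n + 1) → V) :=
    Equiv.arrowCongr Fin.revPerm hσ.toPerm
  apply Fintype.sum_equiv e
  intro f
  have he : ∀ i, e f i = σ (f i.rev) := fun i => by
    simp [e, Equiv.arrowCongr]
  simp only [he, Fin.rev_zero, Fin.rev_last, hσ.injective.eq_iff]
  simp only [and_comm (a := f (Fin.last n) = y)]
  congr 1
  rw [← Equiv.prod_comp Fin.revPerm]
  apply Finset.prod_congr rfl
  intro i _
  rw [hw _ i.2, hσ, hσ]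
  simp only [Fin.revPerm_apply, Fin.rev_succ, Fin.rev_castSucc, Fin.val_rev]
  congr 1
  omega

/-- Vectors with entries at most `a`, supported on `[0,m)`. -/
structure Vec (a m : ℕ) : Type where
  /-- the entries -/
  fn : ℕ → ℕ
  prop : (∀ i, fn i ≤ a) ∧ ∀ i, m ≤ i → fn i = 0

instance (a m : ℕ) : CoeFun (Vec a m) (fun _ => ℕ → ℕ) := ⟨fun v => v.1⟩

theorem Vec.ext {a m : ℕ} {u v : Vec a m} (h : ∀ i, u i = v i) : u = v := by
  cases u
  cases v
  congr 1
  exact funext h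

instance (a m : ℕ) : Finite (Vec a m) := by
  apply Finite.of_injective
    (fun (v : Vec a m) (i : Fin m) => (⟨v i, Nat.lt_succ_of_le (v.2.1 i)⟩ : Fin (a + 1)))
  intro u v h
  apply Vec.ext
  intro i
  by_cases hi : i < m
  · have := congrFun h ⟨i, hi⟩
    simpa using this
  · rw [u.2.2 i (by omega), v.2.2 i (by omega)]

noncomputable instance (a m : ℕ) : Fintype (Vec a m) := Fintype.ofFinite _

/-- the zero vector -/
def Vec.z (a m : ℕ) : Vec a m := ⟨fun _ => 0, fun _ => Nat.zero_le _, fun _ _ => rfl⟩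

@[simp] theorem Vec.z_apply (a m i : ℕ) : Vec.z a m i = 0 := rfl

/-- interlacing -/
def il (κ l : ℕ → ℕ) : Prop := ∀ i, κ i ≤ l i ∧ l (i + 1) ≤ κ i

/-- sum of entries -/
def sz (b : ℕ) (l : ℕ → ℕ) : ℕ := ∑ i ∈ Finset.range b, l i

theorem sz_le {b : ℕ} {κ l : ℕ → ℕ} (h : il κ l) : sz b κ ≤ sz b l :=
  Finset.sum_le_sum fun i _ => (h i).1

open Classical in
/-- horizontal strip weight -/
noncomputable def hw (b : ℕ) (q : ℝ) (κ l : ℕ → ℕ) : ℝ :=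
  if il κ l then q ^ (sz b l - sz b κ) else 0

/-- last passage transition -/
noncomputable def tt (q : ℝ) (x r r' : ℕ) : ℝ :=
  if x ≤ r' ∧ r ≤ r' then q ^ (r' - max x r) else 0

open Classical in
/-- indicator of interlacing -/
noncomputable def ii (κ l : ℕ → ℕ) : ℝ := if il κ l then 1 else 0

theorem local_identity {a n : ℕ} (q : ℝ) (l μ : Vec a (n + 1)) (hl : l n = 0) (r : ℕ)
    (hr : r ≤ a) :
    ∑ κ : Vec a (n + 1), ii κ μ * (hw (n + 1) q κ l * tt q (l 0) (μ 0) r) =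
    ∑ ν : Vec a (n + 1), ii l ν * (hw (n + 1) q μ ν * (if ν 0 = r then 1 else 0)) := by
  classical
  by_cases hm : l 0 ≤ r ∧ μ 0 ≤ r
  swap
  · rw [Finset.sum_eq_zero, Finset.sum_eq_zero]
    · intro ν _
      simp only [ii, hw]
      split_ifs with h1 h2 h3 <;> try simp only [mul_zero, zero_mul]
      exact absurd ⟨h3 ▸ (h1 0).1, h3 ▸ (h2 0).1⟩ hm
    · intro κ _
      simp [tt, hm]
  have hL : ∀ κ : Vec a (n + 1), ii κ μ * (hw (n + 1) q κ l * tt q (l 0) (μ 0) r) =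
      if il κ μ ∧ il κ l then q ^ (sz (n + 1) l - sz (n + 1) κ + (r - max (l 0) (μ 0))) else 0 := by
    intro κ
    simp only [ii, hw, tt, hm, and_self, if_true]
    by_cases h1 : il κ μ <;> by_cases h2 : il κ l <;> simp [h1, h2, pow_add]
  have hR : ∀ ν : Vec a (n + 1),
      ii l ν * (hw (n + 1) q μ ν * (if ν 0 = r then 1 else 0)) =
      if il l ν ∧ il μ ν ∧ ν 0 = r then q ^ (sz (n + 1) ν - sz (n + 1) μ) else 0 := by
    intro ν
    simp only [ii, hw]
    by_cases h1 : il l ν <;> by_cases h2 : il μ ν <;> by_cases h3 : ν 0 = r <;> simp [h1, h2, h3]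
  simp only [hL, hR]
  rw [← Finset.sum_filter, ← Finset.sum_filter]
  have hz : ∀ i, n ≤ i → l i = 0 := fun i hi => by
    rcases Nat.eq_or_lt_of_le hi with h | h
    · rw [← h, hl]
    · exact l.2.2 i h
  have hs : ∀ (f : Vec a (n + 1)) i, n < i → f i = 0 := fun f i hi => f.2.2 i hi
  let F : Vec a (n + 1) → Vec a (n + 1) := fun κ =>
    ⟨fun i => match i with
      | 0 => r
      | i + 1 => min (max (l (i + 1)) (μ (i + 1)) + min (l i) (μ i) - κ i) (min (l i) (μ i)), by
      constructor
      · rintro (_ | i)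
        · exact hr
        · exact (min_le_right _ _).trans ((min_le_left _ _).trans (l.2.1 i))
      · rintro (_ | i) hi
        · omega
        · have := hz i (by omega)
          simp [this]⟩
  let G : Vec a (n + 1) → Vec a (n + 1) := fun ν =>
    ⟨fun i => min (max (l (i + 1)) (μ (i + 1)) + min (l i) (μ i) - ν (i + 1)) (min (l i) (μ i)), by
      constructor
      · intro i
        exact (min_le_right _ _).trans ((min_le_left _ _).trans (l.2.1 i))
      · intro i hi
        have := hz i (by omega)
        simp [this]⟩
  have F0 : ∀ κ, F κ 0 = r := fun _ => rfl
  have FS : ∀ κ i, F κ (i + 1) =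
    min (max (l (i + 1)) (μ (i + 1)) + min (l i) (μ i) - κ i) (min (l i) (μ i)) := fun _ _ => rfl
  have GS : ∀ ν i, G ν i =
    min (max (l (i + 1)) (μ (i + 1)) + min (l i) (μ i) - ν (i + 1)) (min (l i) (μ i)) :=
    fun _ _ => rfl
  apply Finset.sum_bij' (fun κ _ => F κ) (fun ν _ => G ν)
  · intro κ hκ
    simp only [Finset.mem_filter, Finset.mem_univ, true_and] at hκ ⊢
    refine ⟨?_, ?_, F0 κ⟩
    · rintro (_ | i)
      · rw [F0, FS]; omega
      · rw [FS, FS]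
        have h1 := hκ.1 i
        have h2 := hκ.2 i
        have h3 := hκ.1 (i + 1)
        have h4 := hκ.2 (i + 1)
        omega
    · rintro (_ | i)
      · rw [F0, FS]; omega
      · rw [FS, FS]
        have h1 := hκ.1 i
        have h2 := hκ.2 i
        have h3 := hκ.1 (i + 1)
        have h4 := hκ.2 (i + 1)
        omega
  · intro ν hν
    simp only [Finset.mem_filter, Finset.mem_univ, true_and] at hν ⊢
    refine ⟨?_, ?_⟩ <;>
    · intro i
      rw [GS]
      have h1 := hν.1 i
      have h2 := hν.2.1 i
      have h3 := hν.1 (i + 1)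
      have h4 := hν.2.1 (i + 1)
      omega
  · intro κ hκ
    simp only [Finset.mem_filter, Finset.mem_univ, true_and] at hκ
    apply Vec.ext
    intro i
    rw [GS, FS]
    have h1 := hκ.1 i
    have h2 := hκ.2 i
    omega
  · intro ν hν
    simp only [Finset.mem_filter, Finset.mem_univ, true_and] at hν
    apply Vec.ext
    rintro (_ | i)
    · rw [F0, hν.2.2]
    · rw [FS, GS]
      have h1 := hν.1 i
      have h2 := hν.2.1 i
      have h3 := hν.1 (i + 1)
      have h4 := hν.2.1 (i + 1)
      omega
  · intro κ hκ
    simp only [Finset.mem_filter, Finset.mem_univ, true_and] at hκ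
    congr 1
    have hle := sz_le (b := n + 1) hκ.2
    have hκn : κ n = 0 := by have := hκ.2 n; omega
    have e1 : sz (n + 1) (F κ) + sz (n + 1) κ =
        r + ∑ i ∈ Finset.range n, (max (l (i + 1)) (μ (i + 1)) + min (l i) (μ i)) := by
      unfold sz
      rw [Finset.sum_range_succ' (fun i => F κ i), Finset.sum_range_succ (fun i => κ i), hκn, F0]
      have : ∀ i ∈ Finset.range n, max (l (i + 1)) (μ (i + 1)) + min (l i) (μ i) =
          F κ (i + 1) + κ i := by
        intro i _
        rw [FS]
        have h1 := hκ.1 i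
        have h2 := hκ.2 i
        omega
      rw [Finset.sum_congr rfl this, Finset.sum_add_distrib]
      omega
    have e2 : sz (n + 1) l + sz (n + 1) μ = max (l 0) (μ 0) +
        ∑ i ∈ Finset.range n, (max (l (i + 1)) (μ (i + 1)) + min (l i) (μ i)) := by
      unfold sz
      rw [← Finset.sum_add_distrib]
      have : ∀ i ∈ Finset.range (n + 1), l i + μ i = max (l i) (μ i) + min (l i) (μ i) := by
        intro i _; omega
      rw [Finset.sum_congr rfl this, Finset.sum_add_distrib, Finset.sum_range_succ',
        Finset.sum_range_succ (fun i => min (l i) (μ i)), hl, Finset.sum_add_distrib]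
      simp
      omega
    have : max (l 0) (μ 0) ≤ r := max_le hm.1 hm.2
    omega

/-- previous entry, with `0` before the first one -/
def prev (R : ℕ → ℕ) : ℕ → ℕ
  | 0 => 0
  | j + 1 => R j

/-- weights of the `A` chain -/
noncomputable def wA (a b : ℕ) (q : ℕ → ℝ) (R : ℕ → ℕ) (j : ℕ) (κ l : Vec a b) : ℝ :=
  hw b (q j) κ l * tt (q j) (l 0) (prev R j) (R j)

/-- weights of the `B` chain -/
noncomputable def wB (a b : ℕ) (q : ℕ → ℝ) (R : ℕ → ℕ) (j : ℕ) (κ l : Vec a b) : ℝ :=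
  hw b (q j) κ l * (if l 0 = R j then 1 else 0)

theorem KB_zero {a b : ℕ} (q : ℕ → ℝ) (R : ℕ → ℕ) (k : ℕ) (μ : Vec a b)
    (h : μ 0 ≠ prev R k) : K (wB a b q R) (Vec.z a b) k μ = 0 := by
  cases k with
  | zero =>
    simp only [K]
    rw [if_neg]
    rintro rfl
    exact h rfl
  | succ k =>
    simp only [K]
    apply Finset.sum_eq_zero
    intro κ _
    simp only [prev] at h
    simp [wB, h]

theorem il_zero {a b : ℕ} (l : Vec a b) : il l (Vec.z a b) ↔ l = Vec.z a b := by
  constructor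
  · intro h
    apply Vec.ext
    intro i
    have := (h i).1
    simp at this ⊢
    exact this
  · rintro rfl
    intro i
    simp

theorem intertwine {a n : ℕ} (q : ℕ → ℝ) (R : ℕ → ℕ) (hR : ∀ j, R j ≤ a) (k : ℕ) :
    ∀ l : Vec a (n + 1), l n = 0 →
    K (wA a (n + 1) q R) (Vec.z a (n + 1)) k l =
      ∑ μ : Vec a (n + 1), ii l μ * K (wB a (n + 1) q R) (Vec.z a (n + 1)) k μ := by
  classical
  induction k with
  | zero =>
    intro l hl
    simp only [K, mul_ite, mul_one, mul_zero, Finset.sum_ite_eq', Finset.mem_univ, if_true]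
    simp only [ii, il_zero]
  | succ k ih =>
    intro l hl
    have h1 : ∀ κ : Vec a (n + 1),
        K (wA a (n + 1) q R) (Vec.z a (n + 1)) k κ * wA a (n + 1) q R k κ l =
        ∑ μ : Vec a (n + 1), K (wB a (n + 1) q R) (Vec.z a (n + 1)) k μ *
          (ii κ μ * (hw (n + 1) (q k) κ l * tt (q k) (l 0) (μ 0) (R k))) := by
      intro κ
      by_cases hκ : il κ l
      · rw [ih κ (by have := (hκ n).1; omega), Finset.sum_mul]
        apply Finset.sum_congr rfl
        intro μ _
        by_cases hμ : μ 0 = prev R k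
        · rw [hμ]; simp only [wA]; ring
        · rw [KB_zero q R k μ hμ]; simp
      · simp [wA, hw, hκ]
    simp only [K]
    rw [Finset.sum_congr rfl (fun κ _ => h1 κ), Finset.sum_comm]
    simp only [← Finset.mul_sum]
    simp only [local_identity (q k) l _ hl (R k) (hR k), Finset.mul_sum]
    rw [Finset.sum_comm]
    apply Finset.sum_congr rfl
    intro ν _
    apply Finset.sum_congr rfl
    intro μ _
    simp only [wB]
    ring

/-- number of chains -/
noncomputable def NN (a b : ℕ) : ℕ → Vec a b → ℝ :=
  K (fun _ κ l => ii κ l) (Vec.z a b)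

theorem NN_supp {a b : ℕ} (k : ℕ) : ∀ (l : Vec a b) (i : ℕ), k ≤ i → l i ≠ 0 → NN a b k l = 0 := by
  induction k with
  | zero =>
    intro l i _ h
    simp only [NN, K]
    rw [if_neg]
    rintro rfl
    exact h rfl
  | succ k ih =>
    intro l i hi h
    obtain ⟨i, rfl⟩ : ∃ m, i = m + 1 := ⟨i - 1, by omega⟩
    change ∑ κ, NN a b k κ * ii κ l = 0
    apply Finset.sum_eq_zero
    intro κ _
    by_cases hκ : il κ l
    · rw [ih κ i (by omega) (by have := (hκ i).2; omega), zero_mul]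
    · simp [ii, hκ]

/-- transition of the last passage vector -/
noncomputable def TT (c : ℕ) (q : ℕ → ℝ) (R R' : ℕ → ℕ) : ℝ :=
  ∏ j ∈ Finset.range c, tt (q j) (R j) (prev R' j) (R' j)

theorem sum_edge {a b : ℕ} (c : ℕ) (q : ℕ → ℝ) (φ : ℕ → ℕ → ℝ) (l : Vec a b) :
    ∑ R : Vec a c, K (wB a b q R) (Vec.z a b) c l * ∏ j ∈ Finset.range c, φ j (R j) =
    K (fun j (κ l : Vec a b) => hw b (q j) κ l * φ j (l 0)) (Vec.z a b) c l := by
  classical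
  rw [K_path']
  simp only [K_path' (wB a b q _), Finset.sum_mul]
  rw [Finset.sum_comm]
  apply Finset.sum_congr rfl
  intro f _
  split_ifs with hf
  swap
  · simp
  simp only [Finset.prod_range, ← Finset.prod_mul_distrib, wB]
  let R0 : Vec a c := ⟨fun j => if h : j < c then f (Fin.succ ⟨j, h⟩) 0 else 0, by
    constructor
    · intro j
      split_ifs
      · exact (f _).2.1 0
      · exact Nat.zero_le _
    · intro j hj
      exact dif_neg (by omega)⟩
  have hR0 : ∀ j : Fin c, R0 j = f j.succ 0 := fun j => dif_pos j.2
  rw [Finset.sum_eq_single R0]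
  · apply Finset.prod_congr rfl
    intro j _
    rw [hR0]; simp
  · intro R _ hR
    have : ∃ j : Fin c, f j.succ 0 ≠ R j := by
      by_contra hcon
      push Not at hcon
      apply hR
      apply Vec.ext
      intro j
      by_cases hj : j < c
      · rw [← hcon ⟨j, hj⟩, hR0 ⟨j, hj⟩]
      · rw [R.2.2 j (by omega), R0.2.2 j (by omega)]
    obtain ⟨j, hj⟩ := this
    apply Finset.prod_eq_zero (Finset.mem_univ j)
    simp [hj]
  · simp

theorem KB_at_zero {a b : ℕ} (q : ℕ → ℝ) (R : ℕ → ℕ) (k : ℕ) :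
    K (wB a b q R) (Vec.z a b) k (Vec.z a b) = if ∀ j < k, R j = 0 then 1 else 0 := by
  induction k with
  | zero => simp [K]
  | succ k ih =>
    simp only [K]
    rw [Finset.sum_eq_single (Vec.z a b)]
    · rw [ih]
      have : il (Vec.z a b) (Vec.z a b) := (il_zero _).2 rfl
      simp only [wB, hw, this, if_true, Nat.sub_self, pow_zero, one_mul]
      by_cases h : R k = 0
      · by_cases h2 : ∀ j < k, R j = 0
        · have : ∀ j < k + 1, R j = 0 := fun j hj => by
            rcases Nat.lt_succ_iff_lt_or_eq.1 hj with h' | rfl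
            · exact h2 j h'
            · exact h
          rw [if_pos h2, if_pos this]
          simp [h]
        · have : ¬ ∀ j < k + 1, R j = 0 := fun h' => h2 fun j hj => h' j (by omega)
          rw [if_neg h2, if_neg this, zero_mul]
      · have : ¬ ∀ j < k + 1, R j = 0 := fun h' => h (h' k (by omega))
        rw [if_neg this]
        simp [Ne.symm h]
    · intro κ _ hκ
      have : ¬ il κ (Vec.z a b) := fun h => hκ ((il_zero _).1 h)
      simp [wB, hw, this]
    · simp

theorem main_rows {a n c : ℕ} (q : ℕ → ℝ) (i : ℕ) (hi : i ≤ n + 1) : ∀ R : Vec a c,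
    K (fun _ (R R' : Vec a c) => TT c q R R') (Vec.z a c) i R =
      ∑ l : Vec a (n + 1), NN a (n + 1) i l * K (wB a (n + 1) q R) (Vec.z a (n + 1)) c l := by
  classical
  induction i with
  | zero =>
    intro R
    rw [Finset.sum_eq_single (Vec.z a (n + 1))]
    · rw [KB_at_zero]
      simp only [K, NN, if_true, one_mul]
      congr 1
      apply propext
      constructor
      · rintro rfl j _
        rfl
      · intro h
        apply Vec.ext
        intro j
        by_cases hj : j < c
        · rw [h j hj]; rfl
        · rw [R.2.2 j (by omega)]; rfl
    · intro l _ hl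
      simp [NN, K, hl]
    · simp
  | succ i ih =>
    intro R'
    have ih' := ih (by omega)
    simp only [K] 
    simp only [ih', Finset.sum_mul]
    rw [Finset.sum_comm]
    have h1 : ∀ l : Vec a (n + 1),
        ∑ R : Vec a c, NN a (n + 1) i l * K (wB a (n + 1) q R) (Vec.z a (n + 1)) c l * TT c q R R' =
        ∑ μ : Vec a (n + 1), NN a (n + 1) i l *
          (ii l μ * K (wB a (n + 1) q R') (Vec.z a (n + 1)) c μ) := by
      intro l
      simp only [mul_assoc, ← Finset.mul_sum]
      by_cases hl : l n = 0
      · congr 1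
        rw [← intertwine q R' R'.2.1 c l hl]
        exact sum_edge c q (fun j x => tt (q j) x (prev R' j) (R' j)) l
      · rw [NN_supp i l n (by omega) hl, zero_mul, zero_mul]
    rw [Finset.sum_congr rfl (fun l _ => h1 l), Finset.sum_comm]
    apply Finset.sum_congr rfl
    intro μ _
    change _ = (∑ κ, NN a (n + 1) i κ * ii κ μ) * _
    rw [Finset.sum_mul]
    apply Finset.sum_congr rfl
    intro κ _
    ring

theorem main_sum {a n c : ℕ} (q : ℕ → ℝ) :
    ∑ R : Vec a c, K (fun _ (R R' : Vec a c) => TT c q R R') (Vec.z a c) (n + 1) R =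
      ∑ l : Vec a (n + 1), NN a (n + 1) (n + 1) l *
        K (fun j (κ l : Vec a (n + 1)) => hw (n + 1) (q j) κ l) (Vec.z a (n + 1)) c l := by
  simp only [main_rows q (n + 1) le_rfl]
  rw [Finset.sum_comm]
  apply Finset.sum_congr rfl
  intro l _
  rw [← Finset.mul_sum]
  congr 1
  have := sum_edge (a := a) c q (fun _ _ => 1) l
  simpa using this

/-- complement in the first `k` rows -/
def Vec.cpl {a b : ℕ} (k : ℕ) (hk : k ≤ b) (l : Vec a b) : Vec a b :=
  ⟨fun i => if i < k then a - l (k - 1 - i) else 0, by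
    constructor
    · intro i
      split_ifs <;> omega
    · intro i hi
      exact if_neg (by omega)⟩

theorem Vec.cpl_apply {a b : ℕ} (k : ℕ) (hk : k ≤ b) (l : Vec a b) (i : ℕ) :
    l.cpl k hk i = if i < k then a - l (k - 1 - i) else 0 := rfl

theorem Vec.cpl_cpl {a b : ℕ} (k : ℕ) (hk : k ≤ b) (l : Vec a b) (h : ∀ i, k ≤ i → l i = 0) :
    (l.cpl k hk).cpl k hk = l := by
  apply Vec.ext
  intro i
  simp only [Vec.cpl_apply]
  have := l.2.1 i
  by_cases hi : i < k
  · rw [if_pos hi, if_pos (by omega)]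
    have : k - 1 - (k - 1 - i) = i := by omega
    rw [this]
    omega
  · rw [if_neg hi, h i (by omega)]

theorem il_cpl {a b k : ℕ} (hk : k + 1 ≤ b) (κ l : Vec a b) (h : il κ l) :
    il (κ.cpl k (by omega)) (l.cpl (k + 1) hk) := by
  intro i
  simp only [Vec.cpl_apply]
  by_cases hi : i < k
  · rw [if_pos hi, if_pos (by omega), if_pos (by omega)]
    have h1 := h (k - 1 - i)
    have e1 : k - 1 - i + 1 = k + 1 - 1 - i := by omega
    have e2 : k + 1 - 1 - (i + 1) = k - 1 - i := by omega
    rw [e1] at h1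
    rw [e2]
    omega
  · rw [if_neg hi, if_neg (by omega : ¬ i + 1 < k + 1)]
    omega

theorem NN_cpl {a b : ℕ} (k : ℕ) (hk : k ≤ b) : ∀ l : Vec a b, (∀ i, k ≤ i → l i = 0) →
    NN a b k (l.cpl k hk) = NN a b k l := by
  classical
  induction k with
  | zero =>
    intro l hl
    congr 1
    apply Vec.ext
    intro i
    rw [Vec.cpl_apply, hl i (by omega)]
    simp
  | succ k ih =>
    intro l hl
    change ∑ κ, NN a b k κ * ii κ _ = ∑ κ, NN a b k κ * ii κ l
    have hs : ∀ l : Vec a b, ∑ κ, NN a b k κ * ii κ l =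
        ∑ κ with (∀ i, k ≤ i → κ.1 i = 0), NN a b k κ * ii κ l := by
      intro l
      symm
      apply Finset.sum_subset (Finset.subset_univ _)
      intro κ _ hκ
      simp only [Finset.mem_filter, Finset.mem_univ, true_and] at hκ
      push Not at hκ
      obtain ⟨i, hi, h⟩ := hκ
      rw [NN_supp k κ i hi h, zero_mul]
    rw [hs, hs l]
    have hc : ∀ κ : Vec a b, ∀ i, k ≤ i → κ.cpl k (by omega) i = 0 := by
      intro κ i hi
      rw [Vec.cpl_apply, if_neg (by omega)]
    refine Finset.sum_bij' (fun κ _ => κ.cpl k (by omega)) (fun κ _ => κ.cpl k (by omega))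
      ?_ ?_ ?_ ?_ ?_
    · intro κ _
      simpa using hc κ
    · intro κ _
      simpa using hc κ
    · intro κ hκ
      exact Vec.cpl_cpl _ _ _ (by simpa using hκ)
    · intro κ hκ
      exact Vec.cpl_cpl _ _ _ (by simpa using hκ)
    · intro κ hκ
      have hκ' : ∀ i, k ≤ i → κ i = 0 := by simpa using hκ
      rw [ih (by omega) κ hκ']
      congr 1
      unfold ii
      congr 1
      apply propext
      constructor
      · intro h
        have := il_cpl hk κ _ h
        rwa [Vec.cpl_cpl _ _ _ hl] at this
      · intro h
        have := il_cpl hk _ _ h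
        rwa [Vec.cpl_cpl _ _ _ hκ'] at this

/-- the full rectangle -/
def Vec.full (a b : ℕ) : Vec a b := ⟨fun i => if i < b then a else 0, by
  constructor
  · intro i
    split_ifs <;> omega
  · intro i hi
    exact if_neg (by omega)⟩

theorem cpl_full (a b : ℕ) : (Vec.full a b).cpl b le_rfl = Vec.z a b := by
  apply Vec.ext
  intro i
  rw [Vec.cpl_apply]
  simp only [Vec.full, Vec.z]
  split_ifs <;> omega

theorem il_cpl_rev {a b : ℕ} (κ l : Vec a b) (h : il κ l) :
    il (l.cpl b le_rfl) (κ.cpl b le_rfl) := by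
  intro i
  simp only [Vec.cpl_apply]
  by_cases hi : i < b
  · rw [if_pos hi, if_pos hi]
    refine ⟨by have := (h (b - 1 - i)).1; omega, ?_⟩
    split_ifs with h2
    · have := (h (b - 1 - (i + 1))).2
      have e1 : b - 1 - (i + 1) + 1 = b - 1 - i := by omega
      rw [e1] at this
      omega
    · omega
  · rw [if_neg hi, if_neg hi, if_neg (by omega)]
    omega

theorem sz_cpl {a b : ℕ} (l : Vec a b) : sz b (l.cpl b le_rfl) + sz b l = b * a := by
  unfold sz
  rw [← Finset.sum_range_reflect (fun i => l i), ← Finset.sum_add_distrib]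
  rw [Finset.sum_congr rfl (g := fun _ => a)]
  · simp
  · intro i hi
    rw [Vec.cpl_apply, if_pos (by simpa using hi)]
    have := l.2.1 (b - 1 - i)
    omega

theorem hw_cpl {a b : ℕ} (q : ℝ) (κ l : Vec a b) :
    hw b q (l.cpl b le_rfl) (κ.cpl b le_rfl) = hw b q κ l := by
  have hinv : ∀ v : Vec a b, (v.cpl b le_rfl).cpl b le_rfl = v := fun v =>
    Vec.cpl_cpl b le_rfl v v.2.2
  have h : il (l.cpl b le_rfl) (κ.cpl b le_rfl) ↔ il κ l := by
    constructor
    · intro h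
      have := il_cpl_rev _ _ h
      rwa [hinv, hinv] at this
    · exact il_cpl_rev κ l
  unfold hw
  have h1 := sz_cpl l
  have h2 := sz_cpl κ
  by_cases h3 : il κ l
  · rw [if_pos (h.2 h3), if_pos h3]
    congr 1
    have := sz_le (b := b) h3
    omega
  · rw [if_neg (fun h4 => h3 (h.1 h4)), if_neg h3]

theorem schur_chain {a b c : ℕ} (q : ℕ → ℝ) :
    K (fun j (κ l : Vec a b) => hw b (oneExtend b q j) κ l) (Vec.z a b) (b + c) (Vec.full a b) =
    ∑ l : Vec a b, NN a b b l *
        K (fun j (κ l : Vec a b) => hw b (q (c - 1 - j)) κ l) (Vec.z a b) c l := by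
  have hinv : ∀ v : Vec a b, (v.cpl b le_rfl).cpl b le_rfl = v := fun v =>
    Vec.cpl_cpl b le_rfl v v.2.2
  rw [K_add]
  let e : Vec a b ≃ Vec a b := Function.Involutive.toPerm (fun v => v.cpl b le_rfl) hinv
  apply Fintype.sum_equiv e
  intro l
  change _ = NN a b b (l.cpl b le_rfl) * K _ _ _ (l.cpl b le_rfl)
  rw [NN_cpl b le_rfl l l.2.2]
  congr 1
  · have : ∀ k ≤ b, ∀ l : Vec a b, K (fun j (κ l : Vec a b) => hw b (oneExtend b q j) κ l)
        (Vec.z a b) k l = NN a b k l := by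
      intro k
      induction k with
      | zero => intro _ l; rfl
      | succ k ih =>
        intro hk l
        change ∑ κ, _ * _ = ∑ κ, NN a b k κ * ii κ l
        apply Finset.sum_congr rfl
        intro κ _
        rw [ih (by omega)]
        congr 1
        have : oneExtend b q k = 1 := if_pos (by omega)
        simp [hw, ii, this]
    exact this b le_rfl l
  · rw [← cpl_full]
    apply K_rev _ _ (fun v : Vec a b => v.cpl b le_rfl) hinv
    intro j hj u v
    rw [hw_cpl]
    congr 1
    simp only [oneExtend]
    rw [if_neg (by omega)]
    congr 1
    omega

theorem card_lt {a : ℕ} (p : ℕ → Prop) [DecidablePred p] (h1 : ∀ m n, m ≤ n → p n → p m)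
    (h2 : ∀ m, p m → m < a) (m : ℕ) : m < ((Finset.range a).filter p).card ↔ p m := by
  constructor
  · intro h
    by_contra hp
    have : (Finset.range a).filter p ⊆ Finset.range m := by
      intro k hk
      simp only [Finset.mem_filter, Finset.mem_range] at hk ⊢
      by_contra hkm
      exact hp (h1 m k (by omega) hk.2)
    have := Finset.card_le_card this
    simp at this
    omega
  · intro hp
    have : Finset.range (m + 1) ⊆ (Finset.range a).filter p := by
      intro k hk
      simp only [Finset.mem_filter, Finset.mem_range] at hk ⊢
      have := h1 k m (by omega) hp
      exact ⟨h2 k this, this⟩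
    have := Finset.card_le_card this
    simp at this
    omega

theorem pow_Ico {a u v : ℕ} (hv : v ≤ a) (x : ℝ) :
    x ^ (v - u) = ∏ m ∈ Finset.range a, if u ≤ m ∧ m < v then x else 1 := by
  rw [Finset.prod_ite]
  simp only [Finset.prod_const, Finset.prod_const_one, mul_one]
  have : (Finset.range a).filter (fun m => u ≤ m ∧ m < v) = Finset.Ico u v := by
    ext m
    simp
    omega
  rw [this]
  simp

/-- The chain attached to a tableau. -/
def tabChain (a b : ℕ) (T : SemistandardYoungTableau (rectDiagram a b)) (N : ℕ)
    (k : Fin (N + 1)) : Vec a b :=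
  ⟨fun i => if i < b then ((Finset.range a).filter (fun m => m < a ∧ T i m < k)).card else 0, by
    constructor
    · intro i
      split_ifs
      · refine (Finset.card_filter_le _ _).trans (by simp)
      · omega
    · intro i hi
      exact if_neg (by omega)⟩

theorem mem_rect {a b i j : ℕ} : (i, j) ∈ rectDiagram a b ↔ i < b ∧ j < a := by
  change (i, j) ∈ (rectDiagram a b).cells ↔ _
  simp [rectDiagram]

theorem tabChain_lt {a b : ℕ} (T : SemistandardYoungTableau (rectDiagram a b)) {N : ℕ}
    (k : Fin (N + 1)) {i : ℕ} (hi : i < b) (m : ℕ) :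
    m < tabChain a b T N k i ↔ (m < a ∧ T i m < k) := by
  have : tabChain a b T N k i =
    ((Finset.range a).filter (fun m => m < a ∧ T i m < k)).card := if_pos hi
  rw [this]
  apply card_lt
  · intro m n hmn hn
    refine ⟨by omega, ?_⟩
    have := T.row_weak_of_le hmn (mem_rect.2 ⟨hi, hn.1⟩)
    omega
  · intro m hm
    exact hm.1

theorem tabChain_ge {a b : ℕ} (T : SemistandardYoungTableau (rectDiagram a b)) {N : ℕ}
    (k : Fin (N + 1)) {i : ℕ} (hi : b ≤ i) : tabChain a b T N k i = 0 :=
  (tabChain a b T N k).2.2 i hi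

theorem le_of_lt_imp {u v : ℕ} (h : ∀ m, m < u → m < v) : u ≤ v := by
  by_contra hc
  exact absurd (h v (by omega)) (lt_irrefl _)

theorem tabChain_il {a b : ℕ} (T : SemistandardYoungTableau (rectDiagram a b)) {N : ℕ}
    (k : Fin N) : il (tabChain a b T N k.castSucc) (tabChain a b T N k.succ) := by
  intro i
  by_cases hi : i < b
  · constructor
    · apply le_of_lt_imp
      intro m
      rw [tabChain_lt T _ hi, tabChain_lt T _ hi]
      simp only [Fin.val_castSucc, Fin.val_succ]
      omega
    · by_cases hi2 : i + 1 < b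
      · apply le_of_lt_imp
        intro m
        rw [tabChain_lt T _ hi, tabChain_lt T _ hi2]
        simp only [Fin.val_castSucc, Fin.val_succ]
        intro h
        have := T.col_strict (Nat.lt_succ_self i) (mem_rect.2 ⟨hi2, h.1⟩)
        change T i m < T (i + 1) m at this
        omega
      · rw [tabChain_ge T _ (by omega)]
        exact Nat.zero_le _
  · rw [tabChain_ge T _ (by omega), tabChain_ge T _ (by omega), tabChain_ge T _ (by omega)]
    simp

theorem hw_prod {a b : ℕ} (x : ℝ) (κ l : Vec a b) (h : il κ l) :
    hw b x κ l = ∏ i ∈ Finset.range b, ∏ m ∈ Finset.range a,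
      if κ i ≤ m ∧ m < l i then x else 1 := by
  rw [hw, if_pos h]
  simp only [← pow_Ico (l.2.1 _)]
  rw [Finset.prod_pow_eq_pow_sum]
  congr 1
  have : sz b l = ∑ i ∈ Finset.range b, (l i - κ i) + sz b κ := by
    unfold sz
    rw [← Finset.sum_add_distrib]
    apply Finset.sum_congr rfl
    intro i _
    have := (h i).1
    omega
  omega

theorem tab_weight {a b N : ℕ} (x : ℕ → ℝ) (T : SemistandardYoungTableau (rectDiagram a b))
    (hT : ∀ i j, (i, j) ∈ rectDiagram a b → T i j < N) :
    ∏ p ∈ (rectDiagram a b).cells, x (T p.1 p.2) =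
    ∏ k : Fin N, hw b (x k) (tabChain a b T N k.castSucc) (tabChain a b T N k.succ) := by
  have h1 : ∀ k : Fin N, hw b (x k) (tabChain a b T N k.castSucc) (tabChain a b T N k.succ) =
      ∏ i ∈ Finset.range b, ∏ m ∈ Finset.range a, if T i m = k then x k else 1 := by
    intro k
    rw [hw_prod _ _ _ (tabChain_il T k)]
    apply Finset.prod_congr rfl
    intro i hi
    apply Finset.prod_congr rfl
    intro m hm
    simp only [Finset.mem_range] at hi hm
    congr 1
    apply propext
    rw [← not_lt, tabChain_lt T _ hi, tabChain_lt T _ hi]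
    simp only [Fin.val_castSucc, Fin.val_succ]
    omega
  simp only [h1]
  change ∏ p ∈ Finset.range b ×ˢ Finset.range a, _ = _
  rw [Finset.prod_product]
  symm
  rw [Finset.prod_comm]
  apply Finset.prod_congr rfl
  intro i hi
  rw [Finset.prod_comm]
  apply Finset.prod_congr rfl
  intro m hm
  simp only [Finset.mem_range] at hi hm
  have hlt := hT i m (mem_rect.2 ⟨hi, hm⟩)
  rw [Finset.prod_eq_single (⟨T i m, hlt⟩ : Fin N)]
  · simp
  · intro k _ hk
    rw [if_neg]
    intro h
    apply hk
    ext
    exact h.symm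
  · simp

theorem tab_bij (a b N : ℕ) : Set.BijOn (fun T => tabChain a b T N)
    {T : SemistandardYoungTableau (rectDiagram a b) | ∀ i j, (i, j) ∈ rectDiagram a b → T i j < N}
    {f | (f 0 = Vec.z a b ∧ f (Fin.last N) = Vec.full a b) ∧
      ∀ k : Fin N, il (f k.castSucc) (f k.succ)} := by
  refine ⟨?_, ?_, ?_⟩
  · intro T hT
    refine ⟨⟨?_, ?_⟩, fun k => tabChain_il T k⟩
    · apply Vec.ext
      intro i
      by_cases hi : i < b
      · apply Nat.eq_zero_of_not_pos
        intro h
        have := (tabChain_lt T _ hi 0).1 h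
        simp at this
      · exact tabChain_ge T _ (by omega)
    · apply Vec.ext
      intro i
      by_cases hi : i < b
      · have e : Vec.full a b i = a := if_pos hi
        rw [e]
        apply le_antisymm ((tabChain a b T N _).2.1 i)
        apply le_of_lt_imp
        intro m hm
        exact (tabChain_lt T _ hi m).2 ⟨hm, hT i m (mem_rect.2 ⟨hi, hm⟩)⟩
      · rw [tabChain_ge T _ (by omega)]
        exact (if_neg hi).symm
  · intro T hT T' hT' h
    apply SemistandardYoungTableau.ext
    intro i m
    by_cases hm : i < b ∧ m < a
    · have key : ∀ k : Fin (N + 1), T i m < k ↔ T' i m < k := by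
        intro k
        have e : tabChain a b T N k = tabChain a b T' N k := congrFun h k
        have h1 := tabChain_lt T k hm.1 m
        have h2 := tabChain_lt T' k hm.1 m
        rw [e] at h1
        have := h1.symm.trans h2
        have hma := hm.2
        tauto
      have l1 := hT i m (mem_rect.2 hm)
      have l2 := hT' i m (mem_rect.2 hm)
      have k1 := key ⟨T i m + 1, by omega⟩
      have k2 := key ⟨T' i m + 1, by omega⟩
      simp only at k1 k2
      omega
    · rw [T.zeros (fun h => hm (mem_rect.1 h)), T'.zeros (fun h => hm (mem_rect.1 h))]
  · rintro f ⟨⟨f0, fN⟩, hil⟩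
    have mono : ∀ i, Monotone (fun k : Fin (N + 1) => f k i) := by
      intro i
      rw [Fin.monotone_iff_le_succ]
      intro k
      exact (hil k i).1
    let S : ℕ → ℕ → Finset (Fin N) := fun i m => Finset.univ.filter (fun k => f k.succ i ≤ m)
    have key : ∀ (k : Fin (N + 1)) i m, (S i m).card < k ↔ m < f k i := by
      intro k i m
      constructor
      · intro h
        by_contra hc
        have hsub : (Finset.univ.filter (fun j : Fin N => j.1 < k)) ⊆ S i m := by
          intro j hj
          simp only [S, Finset.mem_filter, Finset.mem_univ, true_and] at hj ⊢
          have : j.succ ≤ k := by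
            rw [Fin.le_def]; simp; omega
          have := mono i this
          simp only at this
          omega
        have := Finset.card_le_card hsub
        rw [Fin.card_filter_val_lt] at this
        have := k.2
        omega
      · intro h
        have hk : 0 < k.1 := by
          by_contra hc
          have : k = 0 := Fin.ext (by rw [Fin.val_zero]; omega)
          rw [this, f0] at h
          simp at h
        have hsub : S i m ⊆ (Finset.univ.filter (fun j : Fin N => j.1 < k.1 - 1)) := by
          intro j hj
          simp only [S, Finset.mem_filter, Finset.mem_univ, true_and] at hj ⊢
          by_contra hc
          have : k ≤ j.succ := by
            rw [Fin.le_def]; simp; omega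
          have := mono i this
          simp only at this
          omega
        have := Finset.card_le_card hsub
        rw [Fin.card_filter_val_lt] at this
        omega
    have hS : ∀ i m, i < b → m < a → (S i m).card < N := by
      intro i m hi hm
      have := (key (Fin.last N) i m).2 (by rw [fN]; exact hm.trans_eq (if_pos hi).symm)
      simpa using this
    let T : SemistandardYoungTableau (rectDiagram a b) :=
      { entry := fun i m => if i < b ∧ m < a then (S i m).card else 0
        row_weak' := by
          intro i j1 j2 hj h
          rw [mem_rect] at h
          rw [if_pos ⟨h.1, by omega⟩, if_pos h]
          apply Finset.card_le_card
          intro k hk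
          simp only [S, Finset.mem_filter, Finset.mem_univ, true_and] at hk ⊢
          omega
        col_strict' := by
          intro i1 i2 j hi h
          rw [mem_rect] at h
          rw [if_pos ⟨by omega, h.2⟩, if_pos h]
          by_contra hc
          have hv := hS i1 j (by omega) h.2
          let k : Fin N := ⟨(S i1 j).card, hv⟩
          have h1 := (key k.succ i2 j).1 (by simp [k]; omega)
          have anti : Antitone (fun i => f k.succ i) := by
            apply antitone_nat_of_succ_le
            intro i
            have := hil k i
            omega
          have h2 := anti (show i1 + 1 ≤ i2 by omega)
          simp only at h2
          have h3 := (hil k i1).2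
          have h4 := (key k.castSucc i1 j).2 (by omega)
          simp [k] at h4
        zeros' := by
          intro i j h
          rw [mem_rect] at h
          exact if_neg h }
    have hTe : ∀ i m, i < b → m < a → T i m = (S i m).card := fun i m hi hm => if_pos ⟨hi, hm⟩
    refine ⟨T, ?_, ?_⟩
    · intro i j h
      rw [mem_rect] at h
      rw [hTe i j h.1 h.2]
      exact hS i j h.1 h.2
    · funext k
      apply Vec.ext
      intro i
      by_cases hi : i < b
      · apply le_antisymm
        · apply le_of_lt_imp
          intro m hm
          have := (tabChain_lt T k hi m).1 hm
          rw [hTe i m hi this.1] at this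
          exact (key k i m).1 this.2
        · apply le_of_lt_imp
          intro m hm
          have hma : m < a := lt_of_lt_of_le hm ((f k).2.1 i)
          apply (tabChain_lt T k hi m).2
          rw [hTe i m hi hma]
          exact ⟨hma, (key k i m).2 hm⟩
      · rw [(f k).2.2 i (by omega)]
        exact tabChain_ge T k (by omega)

theorem schur_eq (a b N : ℕ) (x : ℕ → ℝ) : schur (rectDiagram a b) N x =
    K (fun j (κ l : Vec a b) => hw b (x j) κ l) (Vec.z a b) N (Vec.full a b) := by
  classical
  unfold schur
  rw [finsum_mem_eq_of_bijOn (fun T => tabChain a b T N) (tab_bij a b N)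
    (g := fun f => ∏ k : Fin N, hw b (x k) (f k.castSucc) (f k.succ))
    (fun T hT => tab_weight x T hT)]
  rw [finsum_mem_def, finsum_eq_sum_of_fintype, K_path']
  apply Finset.sum_congr rfl
  intro f _
  rw [Set.indicator_apply]
  by_cases h1 : f 0 = Vec.z a b ∧ f (Fin.last N) = Vec.full a b
  · by_cases h2 : ∀ k : Fin N, il (f k.castSucc) (f k.succ)
    · rw [if_pos h1, if_pos ⟨h1, h2⟩]
    · rw [if_pos h1, if_neg (fun h => h2 h.2)]
      push Not at h2
      obtain ⟨k, hk⟩ := h2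
      symm
      apply Finset.prod_eq_zero (Finset.mem_univ k)
      exact if_neg hk
  · rw [if_neg h1, if_neg (fun h => h1 h.1)]

/-- The chain of conjugated rows attached to a plane partition. -/
def ppChain (a b c : ℕ) (π : PlanePartition) (k : Fin (b + 1)) : Vec a c :=
  ⟨fun j => if j < c then
      ((Finset.range a).filter (fun m => m < a ∧ c - j ≤ π.entry (b - k) m)).card else 0, by
    constructor
    · intro i
      split_ifs
      · refine (Finset.card_filter_le _ _).trans (by simp)
      · omega
    · intro i hi
      exact if_neg (by omega)⟩

theorem row_anti (π : PlanePartition) (i : ℕ) : Antitone (π.entry i) :=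
  antitone_nat_of_succ_le (π.row_decr i)

theorem ppChain_lt {a b c : ℕ} {π : PlanePartition} (hπ : π ∈ PP a b c) (k : Fin (b + 1))
    {j : ℕ} (hj : j < c) (m : ℕ) :
    m < ppChain a b c π k j ↔ c - j ≤ π.entry (b - k) m := by
  have : ppChain a b c π k j =
    ((Finset.range a).filter (fun m => m < a ∧ c - j ≤ π.entry (b - k) m)).card := if_pos hj
  rw [this, card_lt]
  · constructor
    · exact fun h => h.2
    · intro h
      refine ⟨?_, h⟩
      by_contra hm
      rw [hπ.1 _ m (by omega)] at h
      omega
  · intro m n hmn hn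
    refine ⟨by omega, ?_⟩
    have := row_anti π (b - k) hmn
    omega
  · intro m hm
    exact hm.1

/-- admissible transitions -/
def ok (c : ℕ) (R R' : ℕ → ℕ) : Prop := ∀ j < c, R j ≤ R' j ∧ prev R' j ≤ R' j

theorem ppChain_ok {a b c : ℕ} {π : PlanePartition} (hπ : π ∈ PP a b c) (k : Fin b) :
    ok c (ppChain a b c π k.castSucc) (ppChain a b c π k.succ) := by
  intro j hj
  constructor
  · apply le_of_lt_imp
    intro m
    rw [ppChain_lt hπ _ hj, ppChain_lt hπ _ hj]
    simp only [Fin.val_castSucc, Fin.val_succ]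
    have := π.col_decr (b - (k + 1)) m
    have e : b - (k + 1) + 1 = b - k := by omega
    rw [e] at this
    omega
  · cases j with
    | zero => exact Nat.zero_le _
    | succ j =>
      apply le_of_lt_imp
      intro m
      simp only [prev]
      rw [ppChain_lt hπ _ hj, ppChain_lt hπ _ (by omega)]
      omega

theorem TT_prod {a c : ℕ} (q : ℕ → ℝ) (R R' : Vec a c) (h : ok c R R') :
    TT c q R R' = ∏ j ∈ Finset.range c, ∏ m ∈ Finset.range a,
      if max (R j) (prev R' j) ≤ m ∧ m < R' j then q j else 1 := by
  unfold TT
  apply Finset.prod_congr rfl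
  intro j hj
  have := h j (by simpa using hj)
  rw [tt, if_pos this, pow_Ico (R'.2.1 j)]

theorem desWeight_eq {a b c : ℕ} {π : PlanePartition} (hπ : π ∈ PP a b c) (q : ℕ → ℝ) :
    desWeight π q = ∏ i ∈ Finset.range b, ∏ m ∈ Finset.range a,
      if π.entry (i + 1) m < π.entry i m then q (π.entry i m - 1) else 1 := by
  classical
  have hs : π.des = ↑((Finset.range b ×ˢ Finset.range a).filter
      (fun p => π.entry (p.1 + 1) p.2 < π.entry p.1 p.2)) := by
    ext p
    simp only [PlanePartition.des, Set.mem_ofPred_eq, Finset.coe_filter, Finset.mem_product,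
      Finset.mem_range]
    constructor
    · intro h
      refine ⟨⟨?_, ?_⟩, h⟩
      · by_contra hc
        rw [hπ.2.1 p.1 p.2 (by omega)] at h
        omega
      · by_contra hc
        rw [hπ.1 p.1 p.2 (by omega)] at h
        omega
    · exact fun h => h.2
  unfold desWeight
  rw [hs, finprod_mem_coe_finset, Finset.prod_filter, Finset.prod_product]

theorem pp_weight {a b c : ℕ} {π : PlanePartition} (hπ : π ∈ PP a b c) (q : ℕ → ℝ) :
    desWeight π q = ∏ k : Fin b, TT c (fun j => q (c - 1 - j))
      (ppChain a b c π k.castSucc) (ppChain a b c π k.succ) := by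
  rw [desWeight_eq hπ, ← Finset.prod_range_reflect, Finset.prod_range]
  apply Finset.prod_congr rfl
  intro k _
  rw [TT_prod _ _ _ (ppChain_ok hπ k), Finset.prod_comm]
  apply Finset.prod_congr rfl
  intro m _
  have hcond : ∀ j ∈ Finset.range c,
      (if max (ppChain a b c π k.castSucc j) (prev (ppChain a b c π k.succ) j) ≤ m ∧
        m < ppChain a b c π k.succ j then q (c - 1 - j) else 1) =
      if π.entry (b - 1 - k) m = c - j ∧ π.entry (b - 1 - k + 1) m < c - j
        then q (c - 1 - j) else 1 := by
    intro j hj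
    rw [Finset.mem_range] at hj
    congr 1
    apply propext
    have e1 : b - (k.castSucc : Fin (b + 1)).1 = b - 1 - k + 1 := by
      simp only [Fin.val_castSucc]; omega
    have e2 : b - (k.succ : Fin (b + 1)).1 = b - 1 - k := by
      simp only [Fin.val_succ]; omega
    have h1 := ppChain_lt hπ k.castSucc hj m
    have h2 := ppChain_lt hπ k.succ hj m
    rw [e1] at h1
    rw [e2] at h2
    have hle := hπ.2.2 (b - 1 - k) m
    rw [h2, max_le_iff]
    cases j with
    | zero =>
      simp only [prev]
      omega
    | succ j =>
      simp only [prev]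
      have h3 := ppChain_lt hπ k.succ (show j < c by omega) m
      rw [e2] at h3
      omega
  rw [Finset.prod_congr rfl hcond]
  have hle := hπ.2.2 (b - 1 - k) m
  split_ifs with h
  · rw [Finset.prod_eq_single (c - π.entry (b - 1 - k) m)]
    · rw [if_pos (by omega)]
      congr 1
      omega
    · intro j hj hne
      rw [if_neg]
      rw [Finset.mem_range] at hj
      omega
    · intro hn
      rw [Finset.mem_range] at hn
      omega
  · symm
    apply Finset.prod_eq_one
    intro j _
    rw [if_neg]
    omega

theorem pp_bij (a b c : ℕ) : Set.BijOn (ppChain a b c) (PP a b c)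
    {f | f 0 = Vec.z a c ∧ ∀ k : Fin b, ok c (f k.castSucc) (f k.succ)} := by
  refine ⟨?_, ?_, ?_⟩
  · intro π hπ
    refine ⟨?_, fun k => ppChain_ok hπ k⟩
    apply Vec.ext
    intro j
    by_cases hj : j < c
    · apply Nat.eq_zero_of_not_pos
      intro h
      have := (ppChain_lt hπ _ hj 0).1 h
      rw [hπ.2.1 _ _ (by simp)] at this
      omega
    · exact (ppChain a b c π 0).2.2 j (by omega)
  · intro π hπ π' hπ' h
    have he : ∀ i m, π.entry i m = π'.entry i m := by
      intro i m
      by_cases hi : i < b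
      · have key : ∀ j < c, (c - j ≤ π.entry i m ↔ c - j ≤ π'.entry i m) := by
          intro j hj
          let k : Fin (b + 1) := ⟨b - i, by omega⟩
          have e : b - k.1 = i := by simp only [k]; omega
          have h1 := ppChain_lt hπ k hj m
          have h2 := ppChain_lt hπ' k hj m
          rw [e] at h1 h2
          rw [h] at h1
          exact h1.symm.trans h2
        have l1 := hπ.2.2 i m
        have l2 := hπ'.2.2 i m
        have k1 := key (c - π.entry i m)
        have k2 := key (c - π'.entry i m)
        omega
      · rw [hπ.2.1 _ _ (by omega), hπ'.2.1 _ _ (by omega)]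
    cases π
    cases π'
    congr 1
    funext i m
    exact he i m
  · rintro f ⟨f0, hok⟩
    have mono : ∀ j, j < c → Monotone (fun k : Fin (b + 1) => f k j) := by
      intro j hj
      rw [Fin.monotone_iff_le_succ]
      intro k
      exact (hok k j hj).1
    have rmono : ∀ k : Fin (b + 1), ∀ j, j + 1 < c → f k j ≤ f k (j + 1) := by
      intro k j hj
      rcases Fin.eq_zero_or_eq_succ k with rfl | ⟨k, rfl⟩
      · rw [f0]; simp
      · exact (hok k (j + 1) hj).2
    have rmono' : ∀ k : Fin (b + 1), ∀ j d, j + d < c → f k j ≤ f k (j + d) := by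
      intro k j d
      induction d with
      | zero => intro _; exact le_rfl
      | succ d ih =>
        intro h
        exact (ih (by omega)).trans (rmono k (j + d) h)
    let S : Fin (b + 1) → ℕ → Finset ℕ := fun k m => (Finset.range c).filter (fun j => m < f k j)
    have key : ∀ k m j, j < c → (c - j ≤ (S k m).card ↔ m < f k j) := by
      intro k m j hj
      constructor
      · intro h
        by_contra hc
        have hsub : S k m ⊆ Finset.Ico (j + 1) c := by
          intro i hi
          simp only [S, Finset.mem_filter, Finset.mem_range, Finset.mem_Ico] at hi ⊢
          refine ⟨?_, hi.1⟩
          by_contra hij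
          have := rmono' k i (j - i) (by omega)
          have e : i + (j - i) = j := by omega
          rw [e] at this
          omega
        have := Finset.card_le_card hsub
        rw [Nat.card_Ico] at this
        omega
      · intro h
        have hsub : Finset.Ico j c ⊆ S k m := by
          intro i hi
          simp only [S, Finset.mem_filter, Finset.mem_range, Finset.mem_Ico] at hi ⊢
          refine ⟨hi.2, ?_⟩
          have := rmono' k j (i - j) (by omega)
          have e : j + (i - j) = i := by omega
          rw [e] at this
          omega
        have := Finset.card_le_card hsub
        rwa [Nat.card_Ico] at this
    have S0 : ∀ m, (S 0 m).card = 0 := by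
      intro m
      simp only [S, f0]
      simp
    have Sa : ∀ k m, a ≤ m → (S k m).card = 0 := by
      intro k m hm
      rw [Finset.card_eq_zero]
      apply Finset.filter_eq_empty_iff.2
      intro j _
      have := (f k).2.1 j
      omega
    let kk : ℕ → Fin (b + 1) := fun i => ⟨b - i, by omega⟩
    have kk0 : ∀ i, b ≤ i → kk i = 0 := fun i hi => Fin.ext (by
      simp only [kk, Fin.val_zero]; omega)
    let π : PlanePartition :=
      { entry := fun i m => (S (kk i) m).card
        row_decr := by
          intro i m
          apply Finset.card_le_card
          intro j hj
          simp only [S, Finset.mem_filter] at hj ⊢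
          exact ⟨hj.1, by omega⟩
        col_decr := by
          intro i m
          apply Finset.card_le_card
          intro j hj
          simp only [S, Finset.mem_filter, Finset.mem_range] at hj ⊢
          refine ⟨hj.1, lt_of_lt_of_le hj.2 (mono j hj.1 ?_)⟩
          rw [Fin.le_def]
          simp only [kk]
          omega
        finite_support := by
          apply Set.Finite.subset (Finset.finite_toSet (Finset.range b ×ˢ Finset.range a))
          intro p hp
          simp only [Set.mem_ofPred_eq] at hp
          simp only [Finset.coe_product, Set.mem_prod, Finset.mem_coe, Finset.mem_range]
          constructor
          · by_contra hc
            rw [kk0 p.1 (by omega), S0] at hp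
            exact hp rfl
          · by_contra hc
            rw [Sa _ _ (by omega)] at hp
            exact hp rfl }
    have hπ : π ∈ PP a b c := by
      refine ⟨fun i j hj => Sa _ _ hj, fun i j hi => ?_, fun i j => ?_⟩
      · change (S (kk i) j).card = 0
        rw [kk0 i hi, S0]
      · exact (Finset.card_filter_le _ _).trans (Finset.card_range c).le
    refine ⟨π, hπ, ?_⟩
    funext k
    apply Vec.ext
    intro j
    by_cases hj : j < c
    · have e : kk (b - k) = k := Fin.ext (by change b - (b - k.1) = k.1; omega)
      have h : ∀ m, m < ppChain a b c π k j ↔ m < f k j := by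
        intro m
        rw [ppChain_lt hπ k hj m]
        change c - j ≤ (S (kk (b - k)) m).card ↔ _
        rw [e, key k m j hj]
      exact le_antisymm (le_of_lt_imp fun m => (h m).1) (le_of_lt_imp fun m => (h m).2)
    · rw [(f k).2.2 j (by omega), (ppChain a b c π k).2.2 j (by omega)]

theorem pp_eq (a b c : ℕ) (q : ℕ → ℝ) : ∑ᶠ π ∈ PP a b c, desWeight π q =
    ∑ R : Vec a c, K (fun _ (R R' : Vec a c) => TT c (fun j => q (c - 1 - j)) R R')
      (Vec.z a c) b R := by
  classical
  rw [finsum_mem_eq_of_bijOn (ppChain a b c) (pp_bij a b c)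
    (g := fun f => ∏ k : Fin b, TT c (fun j => q (c - 1 - j)) (f k.castSucc) (f k.succ))
    (fun π hπ => pp_weight hπ q)]
  have hK := K_path (fun _ (R R' : Vec a c) => TT c (fun j => q (c - 1 - j)) R R')
    (Vec.z a c) b (fun _ => 1)
  simp only [mul_one] at hK
  rw [finsum_mem_def, finsum_eq_sum_of_fintype, hK]
  apply Finset.sum_congr rfl
  intro f _
  rw [Set.indicator_apply]
  by_cases h1 : f 0 = Vec.z a c
  · by_cases h2 : ∀ k : Fin b, ok c (f k.castSucc) (f k.succ)
    · rw [if_pos h1, if_pos ⟨h1, h2⟩]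
    · rw [if_pos h1, if_neg (fun h => h2 h.2)]
      push Not at h2
      obtain ⟨k, hk⟩ := h2
      symm
      apply Finset.prod_eq_zero (Finset.mem_univ k)
      unfold ok at hk
      push Not at hk
      obtain ⟨j, hj, hk⟩ := hk
      apply Finset.prod_eq_zero (Finset.mem_range.2 hj)
      apply if_neg
      intro h
      have := hk h.1
      omega
  · rw [if_neg h1, if_neg (fun h => h1 h.1)]

theorem PP_finite (a b c : ℕ) : (PP a b c).Finite :=
  Set.Finite.of_injOn (pp_bij a b c).1 (pp_bij a b c).2.1 (Set.toFinite _)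

theorem set_eq (a b c : ℕ) : {π ∈ PPinf b c | π.rowLen 0 ≤ a} = PP a b c := by
  ext π
  constructor
  · rintro ⟨⟨h1, h2⟩, h3⟩
    refine ⟨?_, h1, h2⟩
    intro i j hj
    by_contra hne
    have h0 : π.entry 0 j ≠ 0 := by
      have : Antitone (fun i => π.entry i j) := antitone_nat_of_succ_le (fun i => π.col_decr i j)
      have := this (Nat.zero_le i)
      simp only at this
      omega
    have hfin : {j | 0 < π.entry 0 j}.Finite := by
      have := π.finite_support.image Prod.snd
      apply this.subset
      intro m hm
      simp only [Set.mem_ofPred_eq] at hm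
      exact ⟨(0, m), by simp only [Set.mem_ofPred_eq]; omega, rfl⟩
    have hsub : (↑(Finset.range (j + 1)) : Set ℕ) ⊆ {j | 0 < π.entry 0 j} := by
      intro m hm
      simp only [Finset.coe_range, Set.mem_Iio] at hm
      have := row_anti π 0 (show m ≤ j by omega)
      simp only [Set.mem_ofPred_eq]
      omega
    have := Set.ncard_le_ncard hsub hfin
    rw [Set.ncard_coe_finset, Finset.card_range] at this
    unfold PlanePartition.rowLen at h3
    omega
  · rintro ⟨h1, h2, h3⟩
    refine ⟨⟨h2, h3⟩, ?_⟩
    have hsub : {j | 0 < π.entry 0 j} ⊆ (↑(Finset.range a) : Set ℕ) := by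
      intro m hm
      simp only [Set.mem_ofPred_eq] at hm
      simp only [Finset.coe_range, Set.mem_Iio]
      by_contra hc
      rw [h1 0 m (by omega)] at hm
      omega
    have := Set.ncard_le_ncard hsub (Finset.finite_toSet _)
    rwa [Set.ncard_coe_finset, Finset.card_range] at this

theorem main_eq (a b c : ℕ) (hb : 0 < b) (q : ℕ → ℝ) : ∑ᶠ π ∈ PP a b c, desWeight π q
      = schur (rectDiagram a b) (b + c) (oneExtend b q) := by
  obtain ⟨n, rfl⟩ : ∃ n, b = n + 1 := ⟨b - 1, by omega⟩
  rw [pp_eq, schur_eq, schur_chain, main_sum]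

end GM


/-- Distribution of the first part under the `g`-measure: for
`q_1,…,q_c ∈ (0,1)` and a positive integer `a`, the `g`-measure of
`{π ∈ PP(∞,b,c) : λ_1 ≤ a}` equals `Z_{b,c}⁻¹ s_{(a^b)}(1^b, q_1,…,q_c)`;
equivalently `∑_{π ∈ PP(a,b,c)} ∏_{(i,j)∈Des(π)} q_{π_{ij}} = s_{(a^b)}(1^b, q_1,…,q_c)`. -/
theorem gMeasure_first_part (a b c : ℕ) (ha : 0 < a) (hb : 0 < b) (hc : 0 < c)
    (q : ℕ → ℝ) (hq : ∀ i < c, q i ∈ Set.Ioo (0 : ℝ) 1) :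
    ((∏ i ∈ Finset.range c, (1 - q i)⁻¹ ^ b)⁻¹ *
        ∑' π : {π ∈ PPinf b c | π.rowLen 0 ≤ a}, desWeight π.1 q
      = (∏ i ∈ Finset.range c, (1 - q i)⁻¹ ^ b)⁻¹ *
          schur (rectDiagram a b) (b + c) (oneExtend b q)) ∧
    ∑ᶠ π ∈ PP a b c, desWeight π q
      = schur (rectDiagram a b) (b + c) (oneExtend b q) := by
  refine ⟨?_, GM.main_eq a b c hb q⟩
  congr 1
  rw [← GM.main_eq a b c hb q, ← GM.set_eq a b c]
  have hf : ({π ∈ PPinf b c | π.rowLen 0 ≤ a}).Finite := by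
    rw [GM.set_eq]
    exact GM.PP_finite a b c
  haveI := hf.to_subtype
  rw [tsum_eq_finsum (Set.toFinite _)]
  exact finsum_set_coe_eq_finsum_mem (f := fun π => desWeight π q) {π ∈ PPinf b c | π.rowLen 0 ≤ a}
end

section
/- Let q ∈ (0,1), let (w_{ij})_{i∈[1,b], j∈[1,c]} be i.i.d. geometric random variables with P(w_{ij} = k) = (1−q)q^k, and let G(b,c) be the maximum over monotone paths from (1,1) to (b,c) of ∑_{(i,j)∈Π} w_{ij}. Then for every positive integer a: P(G(b,c) ≤ a) = (1−q)^{bc} s_{(a^b)}(1^b, q,…,q), with c arguments equal to q. -/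
open scoped BigOperators

namespace LPP

/-- Growth diagram of a matrix `d`. -/
def gr (d : ℕ → ℕ → ℕ) : ℕ → ℕ → ℕ → ℕ
  | 0, _, _ => 0
  | _ + 1, 0, _ => 0
  | i + 1, j + 1, 0 => d i j + max (gr d i (j + 1) 0) (gr d (i + 1) j 0)
  | i + 1, j + 1, k + 1 =>
      max (gr d i (j + 1) (k + 1)) (gr d (i + 1) j (k + 1)) +
        min (gr d i (j + 1) k) (gr d (i + 1) j k) - gr d i j k
termination_by i j _ => (i, j)

lemma gr_zero_left (d : ℕ → ℕ → ℕ) (j k : ℕ) : gr d 0 j k = 0 := by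
  rw [gr]

lemma gr_zero_right (d : ℕ → ℕ → ℕ) (i k : ℕ) : gr d i 0 k = 0 := by
  cases i <;> rw [gr]

lemma gr_succ_zero (d : ℕ → ℕ → ℕ) (i j : ℕ) :
    gr d (i + 1) (j + 1) 0 = d i j + max (gr d i (j + 1) 0) (gr d (i + 1) j 0) := by
  rw [gr]

lemma gr_succ_succ (d : ℕ → ℕ → ℕ) (i j k : ℕ) :
    gr d (i + 1) (j + 1) (k + 1) =
      max (gr d i (j + 1) (k + 1)) (gr d (i + 1) j (k + 1)) +
        min (gr d i (j + 1) k) (gr d (i + 1) j k) - gr d i j k := by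
  rw [gr]

/-- Interlacing of two sequences. -/
def Inter (u v : ℕ → ℕ) : Prop := ∀ k, u k ≤ v k ∧ v (k + 1) ≤ u k

lemma gr_inter (d : ℕ → ℕ → ℕ) : ∀ i j,
    Inter (gr d i j) (gr d (i + 1) j) ∧ Inter (gr d i j) (gr d i (j + 1)) := by
  intro i
  induction i with
  | zero =>
    intro j
    constructor
    · induction j with
      | zero => intro k; simp [gr_zero_right]
      | succ j ih =>
        intro k
        refine ⟨by simp [gr_zero_left], ?_⟩
        have := (ih k).2
        rw [gr_succ_succ]
        simp only [gr_zero_left] at *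
        omega
    · intro k; simp [gr_zero_left]
  | succ i ih =>
    intro j
    induction j with
    | zero =>
      refine ⟨fun k => by simp [gr_zero_right], fun k => ?_⟩
      refine ⟨by simp [gr_zero_right], ?_⟩
      have h1 := ((ih 0).2 k).2
      rw [gr_succ_succ]
      simp only [gr_zero_right] at *
      omega
    | succ j ihj =>
      -- the square (i,j),(i,j+1),(i+1,j),(i+1,j+1) interlaces
      have key : ∀ p r, Inter (gr d p r) (gr d (p+1) r) → Inter (gr d p r) (gr d p (r+1)) →
          Inter (gr d p (r+1)) (gr d (p+1) (r+1)) ∧ Inter (gr d (p+1) r) (gr d (p+1) (r+1)) := by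
        intro p r h1 h2
        constructor
        · intro k
          constructor
          · cases k with
            | zero => rw [gr_succ_zero]; omega
            | succ k =>
              rw [gr_succ_succ]
              have := h1 k; have := h2 k; omega
          · rw [gr_succ_succ]
            have := h1 k; have := h2 k; omega
        · intro k
          constructor
          · cases k with
            | zero => rw [gr_succ_zero]; omega
            | succ k =>
              rw [gr_succ_succ]
              have := h1 k; have := h2 k; omega
          · rw [gr_succ_succ]
            have := h1 k; have := h2 k; omega
      have s1 := key (i+1) j ihj.1 ihj.2
      have s0 := key i (j+1) (ih (j+1)).1 (ih (j+1)).2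
      exact ⟨s1.1, s0.2⟩

lemma gr_rule (d : ℕ → ℕ → ℕ) (i j k : ℕ) :
    gr d (i + 1) (j + 1) (k + 1) + gr d i j k =
      max (gr d i (j + 1) (k + 1)) (gr d (i + 1) j (k + 1)) +
        min (gr d i (j + 1) k) (gr d (i + 1) j k) := by
  rw [gr_succ_succ]
  have h1 := (gr_inter d i j).1 k
  have h2 := (gr_inter d i j).2 k
  omega

lemma gr_supp (d : ℕ → ℕ → ℕ) : ∀ i j k, (i ≤ k ∨ j ≤ k) → gr d i j k = 0 := by
  intro i
  induction i with
  | zero => intros; rw [gr_zero_left]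
  | succ i ih =>
    intro j
    induction j with
    | zero => intros; rw [gr_zero_right]
    | succ j ihj =>
      intro k hk
      cases k with
      | zero => omega
      | succ k =>
        have h := gr_rule d i j k
        rcases hk with hk | hk
        · have h1 := ih (j+1) (k+1) (by omega)
          have h2 := ih (j+1) (k) (by omega)
          have h3 := ihj (k+1) (by omega)
          omega
        · have h1 := ih (j+1) (k+1) (by omega)
          have h2 := ihj (k) (by omega)
          have h3 := ihj (k+1) (by omega)
          omega

lemma gr_sum (d : ℕ → ℕ → ℕ) (n : ℕ) : ∀ i j, i ≤ n →
    ∑ k ∈ Finset.range n, gr d i j k =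
      ∑ p ∈ Finset.range i, ∑ r ∈ Finset.range j, d p r := by
  intro i
  induction i with
  | zero => intro j _; simp [gr_zero_left]
  | succ i ih =>
    intro j hi
    induction j with
    | zero => simp [gr_zero_right]
    | succ j ihj =>
      have e1 := ih j (by omega)
      have e2 := ih (j+1) (by omega)
      have A : ∑ k ∈ Finset.range n, gr d (i+1) (j+1) (k+1) + ∑ k ∈ Finset.range n, gr d i j k
         = ∑ k ∈ Finset.range n, max (gr d i (j + 1) (k + 1)) (gr d (i + 1) j (k + 1)) +
          ∑ k ∈ Finset.range n, min (gr d i (j + 1) k) (gr d (i + 1) j k) := by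
        rw [← Finset.sum_add_distrib, ← Finset.sum_add_distrib]
        exact Finset.sum_congr rfl fun k _ => gr_rule d i j k
      have B : ∑ k ∈ Finset.range n, max (gr d i (j + 1) k) (gr d (i + 1) j k) +
          ∑ k ∈ Finset.range n, min (gr d i (j + 1) k) (gr d (i + 1) j k) =
          ∑ k ∈ Finset.range n, gr d i (j + 1) k + ∑ k ∈ Finset.range n, gr d (i + 1) j k := by
        rw [← Finset.sum_add_distrib, ← Finset.sum_add_distrib]
        exact Finset.sum_congr rfl fun k _ => by omega
      have C1 := Finset.sum_range_succ' (fun k => gr d (i+1) (j+1) k) n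
      have C2 := Finset.sum_range_succ (fun k => gr d (i+1) (j+1) k) n
      have D1 := Finset.sum_range_succ'
        (fun k => max (gr d i (j + 1) k) (gr d (i + 1) j k)) n
      have D2 := Finset.sum_range_succ
        (fun k => max (gr d i (j + 1) k) (gr d (i + 1) j k)) n
      have z1 := gr_supp d (i+1) (j+1) n (by omega)
      have z2 := gr_supp d (i+1) j n (by omega)
      have z3 := gr_supp d i (j+1) n (by omega)
      have g0 := gr_succ_zero d i j
      have R : ∀ J, ∑ p ∈ Finset.range (i+1), ∑ r ∈ Finset.range J, d p r =
        ∑ p ∈ Finset.range i, ∑ r ∈ Finset.range J, d p r + ∑ r ∈ Finset.range J, d i r :=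
        fun J => Finset.sum_range_succ _ _
      have R2 := Finset.sum_range_succ (fun r => d i r) j
      have r1 := R j
      have r2 := R (j+1)
      omega

/-- paths -/
lemma path_le (d : ℕ → ℕ → ℕ) (L : List (ℕ × ℕ)) : ∀ t, IsMonPath L (0, 0) t →
    (L.map fun p => d p.1 p.2).sum ≤ gr d (t.1 + 1) (t.2 + 1) 0 := by
  induction L using List.reverseRecOn with
  | nil => intro t h; simp [IsMonPath] at h
  | append_singleton L x ih =>
    rintro t ⟨h1, h2, h3⟩
    have hx : x = t := by simpa using h2
    subst hx
    rw [gr_succ_zero]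
    rcases List.eq_nil_or_concat L with rfl | ⟨L', y, rfl⟩
    · simp
    · rw [List.concat_eq_append] at *
      have h3' := List.isChain_append.1 h3
      have hp : IsMonPath (L' ++ [y]) (0, 0) y := by
        refine ⟨?_, by simp, h3'.1⟩
        rw [List.head?_append_of_ne_nil _ (by simp)] at h1
        exact h1
      have hs := ih y hp
      have hyx := h3'.2.2 y (by simp) x (by simp)
      rw [List.map_append, List.sum_append]
      simp only [List.map_cons, List.map_nil, List.sum_cons, List.sum_nil, add_zero]
      rcases hyx with h | h
      · have e1 : x.1 = y.1 + 1 := by rw [h]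
        have e2 : x.2 = y.2 := by rw [h]
        rw [← e1, ← e2] at hs
        omega
      · have e1 : x.1 = y.1 := by rw [h]
        have e2 : x.2 = y.2 + 1 := by rw [h]
        rw [← e1, ← e2] at hs
        omega

lemma path_ext {L : List (ℕ × ℕ)} {s y x : ℕ × ℕ} (h : IsMonPath L s y)
    (hx : x = (y.1 + 1, y.2) ∨ x = (y.1, y.2 + 1)) : IsMonPath (L ++ [x]) s x := by
  obtain ⟨h1, h2, h3⟩ := h
  refine ⟨?_, by simp, ?_⟩
  · cases L with
    | nil => simp at h1
    | cons a l => simpa using h1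
  · refine List.isChain_append.2 ⟨h3, by simp, ?_⟩
    intro u hu v hv
    rw [h2] at hu
    simp at hu hv
    subst hu; subst hv; exact hx

lemma path_ex (d : ℕ → ℕ → ℕ) : ∀ i j, ∃ L, IsMonPath L (0, 0) (i, j) ∧
    gr d (i + 1) (j + 1) 0 = (L.map fun p => d p.1 p.2).sum := by
  intro i
  induction i with
  | zero =>
    intro j
    induction j with
    | zero => exact ⟨[(0,0)], ⟨rfl, rfl, List.isChain_singleton _⟩, by simp [gr_succ_zero, gr_zero_left, gr_zero_right]⟩
    | succ j ih =>
      obtain ⟨L, hL, e⟩ := ih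
      refine ⟨L ++ [(0, j+1)], path_ext hL (Or.inr rfl), ?_⟩
      rw [gr_succ_zero]
      simp [gr_zero_left, e, add_comm]
  | succ i ih =>
    intro j
    induction j with
    | zero =>
      obtain ⟨L, hL, e⟩ := ih 0
      refine ⟨L ++ [(i+1, 0)], path_ext hL (Or.inl rfl), ?_⟩
      rw [gr_succ_zero]
      simp only [zero_add] at e
      simp [gr_zero_right, e, add_comm]
    | succ j ihj =>
      rw [gr_succ_zero]
      rcases le_total (gr d (i+1) (j+1+1) 0) (gr d (i+1+1) (j+1) 0) with h | h
      · obtain ⟨L, hL, e⟩ := ihj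
        refine ⟨L ++ [(i+1, j+1)], path_ext hL (Or.inr rfl), ?_⟩
        rw [max_eq_right h, e]
        simp [add_comm]
      · obtain ⟨L, hL, e⟩ := ih (j+1)
        refine ⟨L ++ [(i+1, j+1)], path_ext hL (Or.inl rfl), ?_⟩
        rw [max_eq_left h, e]
        simp [add_comm]

lemma lastPassage_eq (d : ℕ → ℕ → ℕ) (i j : ℕ) :
    lastPassage d (0, 0) (i, j) = gr d (i + 1) (j + 1) 0 := by
  apply IsGreatest.csSup_eq
  constructor
  · exact path_ex d i j
  · rintro n ⟨L, hL, rfl⟩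
    exact path_le d L (i, j) hL

/-- boundary data of an array -/
def bd (π : ℕ → ℕ → ℕ) (i j k : ℕ) : ℕ :=
  if k < i ∧ k < j then π (i - 1 - k) (j - 1 - k) else 0

/-- Reverse plane partitions of shape `b × c`, entries at most `a`. -/
def RPP (a b c : ℕ) : Set (ℕ → ℕ → ℕ) :=
  {π | (∀ i j, b ≤ i ∨ c ≤ j → π i j = 0) ∧ (∀ i j, i + 1 < b → j < c → π i j ≤ π (i + 1) j) ∧
    (∀ i j, i < b → j + 1 < c → π i j ≤ π i (j + 1)) ∧ ∀ i j, π i j ≤ a}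

lemma bd_inter_right {a b c : ℕ} {π : ℕ → ℕ → ℕ} (h : π ∈ RPP a b c) (i j : ℕ) (hi : i ≤ b)
    (hj : j + 1 ≤ c) : Inter (bd π i j) (bd π i (j + 1)) := by
  intro k
  unfold bd
  constructor
  · by_cases h1 : k < i ∧ k < j
    · rw [if_pos h1, if_pos (by omega)]
      have := h.2.2.1 (i - 1 - k) (j - 1 - k) (by omega) (by omega)
      rwa [show j - 1 - k + 1 = j + 1 - 1 - k by omega] at this
    · rw [if_neg h1]; omega
  · by_cases h1 : k + 1 < i ∧ k + 1 < j + 1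
    · rw [if_pos h1, if_pos (by omega)]
      have := h.2.1 (i - 1 - (k + 1)) (j - 1 - k) (by omega) (by omega)
      rw [show i - 1 - (k + 1) + 1 = i - 1 - k by omega] at this
      rwa [show j + 1 - 1 - (k + 1) = j - 1 - k by omega]
    · rw [if_neg h1]; omega

lemma bd_inter_left {a b c : ℕ} {π : ℕ → ℕ → ℕ} (h : π ∈ RPP a b c) (i j : ℕ) (hi : i + 1 ≤ b)
    (hj : j ≤ c) : Inter (bd π i j) (bd π (i + 1) j) := by
  intro k
  unfold bd
  constructor
  · by_cases h1 : k < i ∧ k < j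
    · rw [if_pos h1, if_pos (by omega)]
      have := h.2.1 (i - 1 - k) (j - 1 - k) (by omega) (by omega)
      rwa [show i - 1 - k + 1 = i + 1 - 1 - k by omega] at this
    · rw [if_neg h1]; omega
  · by_cases h1 : k + 1 < i + 1 ∧ k + 1 < j
    · rw [if_pos h1, if_pos (by omega)]
      have := h.2.2.1 (i - 1 - k) (j - 1 - (k + 1)) (by omega) (by omega)
      rw [show j - 1 - (k + 1) + 1 = j - 1 - k by omega] at this
      rwa [show i + 1 - 1 - (k + 1) = i - 1 - k by omega]
    · rw [if_neg h1]; omega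

/-- Backward growth: `bk π b c i j` is the sequence at position `(b - i, c - j)`. -/
def bk (π : ℕ → ℕ → ℕ) (b c : ℕ) : ℕ → ℕ → ℕ → ℕ
  | 0, j, k => bd π b (c - j) k
  | i + 1, 0, k => bd π (b - (i + 1)) c k
  | i + 1, j + 1, k =>
      max (bk π b c (i + 1) j (k + 1)) (bk π b c i (j + 1) (k + 1)) +
        min (bk π b c (i + 1) j k) (bk π b c i (j + 1) k) - bk π b c i j (k + 1)
termination_by i j _ => (i, j)

lemma bk_zero_left (π : ℕ → ℕ → ℕ) (b c j k : ℕ) : bk π b c 0 j k = bd π b (c - j) k := by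
  rw [bk]

lemma bk_zero_right (π : ℕ → ℕ → ℕ) (b c i k : ℕ) : bk π b c i 0 k = bd π (b - i) c k := by
  cases i <;> rw [bk] <;> rfl

lemma bk_succ (π : ℕ → ℕ → ℕ) (b c i j k : ℕ) : bk π b c (i + 1) (j + 1) k =
      max (bk π b c (i + 1) j (k + 1)) (bk π b c i (j + 1) (k + 1)) +
        min (bk π b c (i + 1) j k) (bk π b c i (j + 1) k) - bk π b c i j (k + 1) := by
  rw [bk]

lemma bk_inter {a b c : ℕ} {π : ℕ → ℕ → ℕ} (h : π ∈ RPP a b c) : ∀ i j,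
    (i < b → j ≤ c → Inter (bk π b c (i + 1) j) (bk π b c i j)) ∧
    (i ≤ b → j < c → Inter (bk π b c i (j + 1)) (bk π b c i j)) := by
  have key : ∀ p r, Inter (bk π b c (p+1) r) (bk π b c p r) →
      Inter (bk π b c p (r+1)) (bk π b c p r) →
      Inter (bk π b c (p+1) (r+1)) (bk π b c p (r+1)) ∧
      Inter (bk π b c (p+1) (r+1)) (bk π b c (p+1) r) := by
    intro p r h1 h2
    constructor
    · intro k
      rw [bk_succ]
      have := h1 k; have := h2 k; have := h1 (k+1); have := h2 (k+1)
      omega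
    · intro k
      rw [bk_succ]
      have := h1 k; have := h2 k; have := h1 (k+1); have := h2 (k+1)
      omega
  intro i
  induction i with
  | zero =>
    intro j
    have hright : ∀ j, 0 ≤ b → j < c → Inter (bk π b c 0 (j + 1)) (bk π b c 0 j) := by
      intro j _ hj k
      simp only [bk_zero_left]
      have := bd_inter_right h b (c - (j+1)) le_rfl (by omega) k
      rwa [show c - (j + 1) + 1 = c - j by omega] at this
    refine ⟨?_, hright j⟩
    induction j with
    | zero =>
      intro hb _ k
      simp only [bk_zero_right]
      have := bd_inter_left h (b - (0+1)) c (by omega) le_rfl k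
      rwa [show b - (0 + 1) + 1 = b - 0 by omega] at this
    | succ j ih =>
      intro hb hj
      exact (key 0 j (ih hb (by omega)) (hright j (by omega) (by omega))).1
  | succ i ih =>
    intro j
    have hright : ∀ j, i + 1 ≤ b → j < c → Inter (bk π b c (i+1) (j + 1)) (bk π b c (i+1) j) :=
      fun j hi hj => (key i j ((ih j).1 (by omega) (by omega)) ((ih j).2 (by omega) hj)).2
    refine ⟨?_, hright j⟩
    induction j with
    | zero =>
      intro hb _ k
      simp only [bk_zero_right]
      have := bd_inter_left h (b - (i+1+1)) c (by omega) le_rfl k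
      rwa [show b - (i + 1 + 1) + 1 = b - (i + 1) by omega] at this
    | succ j ihj =>
      intro hb hj
      exact (key (i+1) j (ihj hb (by omega)) (hright j (by omega) (by omega))).1

lemma bd_supp (π : ℕ → ℕ → ℕ) (i j k : ℕ) (h : i ≤ k ∨ j ≤ k) : bd π i j k = 0 := by
  unfold bd; rw [if_neg (by omega)]

lemma bk_supp (π : ℕ → ℕ → ℕ) (b c : ℕ) : ∀ i j k, (b - i ≤ k ∨ c - j ≤ k) →
    bk π b c i j k = 0 := by
  intro i
  induction i with
  | zero => intro j k h; rw [bk_zero_left]; exact bd_supp _ _ _ _ (by omega)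
  | succ i ih =>
    intro j
    induction j with
    | zero => intro k h; rw [bk_zero_right]; exact bd_supp _ _ _ _ (by omega)
    | succ j ihj =>
      intro k h
      rw [bk_succ]
      rcases h with h | h
      · have h1 := ihj (k+1) (by omega)
        have h2 := ihj k (by omega)
        have h3 := ih (j+1) (k+1) (by omega)
        omega
      · have h1 := ihj (k+1) (by omega)
        have h2 := ih (j+1) k (by omega)
        have h3 := ih (j+1) (k+1) (by omega)
        omega

/-- The matrix recovered from the array. -/
def bkw (π : ℕ → ℕ → ℕ) (b c i j : ℕ) : ℕ :=
  bk π b c (b - (i + 1)) (c - (j + 1)) 0 -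
    max (bk π b c (b - i) (c - (j + 1)) 0) (bk π b c (b - (i + 1)) (c - j) 0)

lemma gr_bk {a b c : ℕ} {π : ℕ → ℕ → ℕ} (h : π ∈ RPP a b c) (d : ℕ → ℕ → ℕ)
    (hd : ∀ i j, i < b → j < c → d i j = bkw π b c i j) : ∀ i j, i ≤ b → j ≤ c → ∀ k,
    gr d i j k = bk π b c (b - i) (c - j) k := by
  intro i
  induction i with
  | zero => intro j _ _ k; rw [gr_zero_left, bk_supp]; omega
  | succ i ih =>
    intro j
    induction j with
    | zero => intro _ _ k; rw [gr_zero_right, bk_supp]; omega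
    | succ j ihj =>
      intro hi hj k
      have i1 := (bk_inter h (b - (i+1)) (c - (j+1))).1 (by omega) (by omega)
      have i2 := (bk_inter h (b - (i+1)) (c - (j+1))).2 (by omega) (by omega)
      rw [show b - (i + 1) + 1 = b - i by omega] at i1
      rw [show c - (j + 1) + 1 = c - j by omega] at i2
      cases k with
      | zero =>
        rw [gr_succ_zero, hd i j (by omega) (by omega), ih (j+1) (by omega) hj,
          ihj hi (by omega)]
        unfold bkw
        have := i1 0
        have := i2 0
        omega
      | succ k =>
        rw [gr_succ_succ, ih (j+1) (by omega) hj, ihj hi (by omega), ih (j+1) (by omega) hj,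
          ihj hi (by omega), ih j (by omega) (by omega)]
        have e := bk_succ π b c (b - (i+1)) (c - (j+1)) k
        rw [show b - (i + 1) + 1 = b - i by omega, show c - (j + 1) + 1 = c - j by omega] at e
        have := i1 k
        have := i2 k
        have := i1 (k+1)
        have := i2 (k+1)
        omega

/-- The array of a growth diagram. -/
def arr (b c : ℕ) (d : ℕ → ℕ → ℕ) (r s : ℕ) : ℕ :=
  if r < b ∧ s < c then
    gr d (r + min (b - 1 - r) (c - 1 - s) + 1) (s + min (b - 1 - r) (c - 1 - s) + 1)
      (min (b - 1 - r) (c - 1 - s))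
  else 0

lemma bd_arr (b c : ℕ) (d : ℕ → ℕ → ℕ) (i j k : ℕ) (h : (i = b ∧ j ≤ c) ∨ (i ≤ b ∧ j = c)) :
    bd (arr b c d) i j k = gr d i j k := by
  unfold bd
  by_cases h1 : k < i ∧ k < j
  · rw [if_pos h1]
    unfold arr
    rw [if_pos (by omega)]
    have : min (b - 1 - (i - 1 - k)) (c - 1 - (j - 1 - k)) = k := by omega
    rw [this, show i - 1 - k + k + 1 = i by omega, show j - 1 - k + k + 1 = j by omega]
  · rw [if_neg h1, gr_supp]; omega

lemma RPP_le {a b c : ℕ} {π : ℕ → ℕ → ℕ} 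
    (h1 : ∀ i j, i + 1 < b → j < c → π i j ≤ π (i + 1) j)
    (h2 : ∀ i j, i < b → j + 1 < c → π i j ≤ π i (j + 1))
    (h3 : π (b - 1) (c - 1) ≤ a) (i j : ℕ) (hi : i < b) (hj : j < c) : π i j ≤ a := by
  have A : ∀ n, ∀ i, i < b → i + n = b - 1 → π i j ≤ π (b - 1) j := by
    intro n
    induction n with
    | zero => intro i hi e; rw [← e]; rfl
    | succ n ih => intro i hi e; exact (h1 i j (by omega) hj).trans (ih (i+1) (by omega) (by omega))
  have B : ∀ n, ∀ j, j < c → j + n = c - 1 → π (b - 1) j ≤ π (b - 1) (c - 1) := by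
    intro n
    induction n with
    | zero => intro i hi e; rw [← e]; rfl
    | succ n ih =>
      intro j hj e
      exact (h2 (b-1) j (by omega) (by omega)).trans (ih (j+1) (by omega) (by omega))
  exact ((A (b - 1 - i) i hi (by omega)).trans (B (c - 1 - j) j hj (by omega))).trans h3

lemma arr_mem {a b c : ℕ} (hb : 0 < b) (hc : 0 < c) (d : ℕ → ℕ → ℕ) (hd : gr d b c 0 ≤ a) :
    arr b c d ∈ RPP a b c := by
  have m1 : ∀ i j, i + 1 < b → j < c → arr b c d i j ≤ arr b c d (i + 1) j := by
    intro i j hi hj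
    unfold arr
    rw [if_pos (by omega), if_pos (by omega)]
    by_cases h : b - 1 - i ≤ c - 1 - j
    · obtain ⟨e, he⟩ : ∃ e, b = i + e + 2 := ⟨b - i - 2, by omega⟩
      rw [show min (b - 1 - i) (c - 1 - j) = e + 1 by omega,
        show min (b - 1 - (i+1)) (c - 1 - j) = e by omega,
        show i + 1 + e + 1 = i + (e + 1) + 1 by omega]
      exact ((gr_inter d (i + (e+1) + 1) (j + e + 1)).2 e).2
    · rw [show min (b - 1 - i) (c - 1 - j) = c - 1 - j by omega,
        show min (b - 1 - (i+1)) (c - 1 - j) = c - 1 - j by omega,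
        show i + 1 + (c - 1 - j) + 1 = i + (c - 1 - j) + 1 + 1 by omega]
      exact ((gr_inter d _ _).1 _).1
  have m2 : ∀ i j, i < b → j + 1 < c → arr b c d i j ≤ arr b c d i (j + 1) := by
    intro i j hi hj
    unfold arr
    rw [if_pos (by omega), if_pos (by omega)]
    by_cases h : c - 1 - j ≤ b - 1 - i
    · obtain ⟨e, he⟩ : ∃ e, c = j + e + 2 := ⟨c - j - 2, by omega⟩
      rw [show min (b - 1 - i) (c - 1 - j) = e + 1 by omega,
        show min (b - 1 - i) (c - 1 - (j + 1)) = e by omega,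
        show j + 1 + e + 1 = j + (e + 1) + 1 by omega]
      exact ((gr_inter d (i + e + 1) (j + (e + 1) + 1)).1 e).2
    · rw [show min (b - 1 - i) (c - 1 - j) = b - 1 - i by omega,
        show min (b - 1 - i) (c - 1 - (j + 1)) = b - 1 - i by omega,
        show j + 1 + (b - 1 - i) + 1 = j + (b - 1 - i) + 1 + 1 by omega]
      exact ((gr_inter d _ _).2 _).1
  have hcor : arr b c d (b - 1) (c - 1) ≤ a := by
    have := bd_arr b c d b c 0 (by omega)
    unfold bd at this
    rw [if_pos (by omega)] at this
    rw [Nat.sub_zero, Nat.sub_zero] at this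
    rw [this]
    exact hd
  refine ⟨?_, m1, m2, ?_⟩
  · intro i j h; unfold arr; rw [if_neg (by omega)]
  · intro i j
    by_cases h : i < b ∧ j < c
    · exact RPP_le m1 m2 hcor i j h.1 h.2
    · unfold arr; rw [if_neg h]; omega

/-- Injectivity. -/
lemma gr_inj (b c : ℕ) (d d' : ℕ → ℕ → ℕ) (h : arr b c d = arr b c d') :
    ∀ i j, i < b → j < c → d i j = d' i j := by
  have B : ∀ n m, n ≤ b → m ≤ c → ∀ k, gr d (b - n) (c - m) k = gr d' (b - n) (c - m) k := by
    intro n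
    induction n with
    | zero =>
      intro m _ _ k
      rw [← bd_arr b c d _ _ k (by omega), ← bd_arr b c d' _ _ k (by omega), h]
    | succ n ih =>
      intro m
      induction m with
      | zero =>
        intro _ _ k
        rw [← bd_arr b c d _ _ k (by omega), ← bd_arr b c d' _ _ k (by omega), h]
      | succ m ihm =>
        intro hn hm k
        have r1 := gr_rule d (b - (n+1)) (c - (m+1)) k
        have r2 := gr_rule d' (b - (n+1)) (c - (m+1)) k
        rw [show b - (n + 1) + 1 = b - n by omega, show c - (m + 1) + 1 = c - m by omega] at r1 r2
        have := ih m (by omega) (by omega) (k+1)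
        have := ih (m+1) (by omega) (by omega) (k+1)
        have := ih (m+1) (by omega) (by omega) k
        have := ihm (by omega) (by omega) (k+1)
        have := ihm (by omega) (by omega) k
        omega
  have B' : ∀ i j, i ≤ b → j ≤ c → ∀ k, gr d i j k = gr d' i j k := by
    intro i j hi hj k
    have := B (b - i) (c - j) (by omega) (by omega) k
    rwa [show b - (b - i) = i by omega, show c - (c - j) = j by omega] at this
  intro i j hi hj
  have r1 := gr_succ_zero d i j
  have r2 := gr_succ_zero d' i j
  rw [B' _ _ (by omega) (by omega), B' _ _ (by omega) (by omega),
    B' _ _ (by omega) (by omega)] at r1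
  omega

lemma arr_surj {a b c : ℕ} {π : ℕ → ℕ → ℕ} (h : π ∈ RPP a b c) (d : ℕ → ℕ → ℕ)
    (hd : ∀ i j, i < b → j < c → d i j = bkw π b c i j) : arr b c d = π := by
  funext r s
  unfold arr
  split_ifs with hrs
  · rw [gr_bk h d hd _ _ (by omega) (by omega)]
    by_cases hm : b - 1 - r ≤ c - 1 - s
    · rw [show min (b - 1 - r) (c - 1 - s) = b - 1 - r by omega,
        show b - (r + (b - 1 - r) + 1) = 0 by omega, bk_zero_left]
      unfold bd
      rw [if_pos (by omega)]
      congr 1 <;> omega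
    · rw [show min (b - 1 - r) (c - 1 - s) = c - 1 - s by omega,
        show c - (s + (c - 1 - s) + 1) = 0 by omega, bk_zero_right]
      unfold bd
      rw [if_pos (by omega)]
      congr 1 <;> omega
  · rw [h.1 r s (by omega)]

/-- weight of an array -/
def wt (b c : ℕ) (π : ℕ → ℕ → ℕ) : ℕ := ∑ k ∈ Finset.range b, bd π b c k

lemma wt_arr (b c : ℕ) (d : ℕ → ℕ → ℕ) : wt b c (arr b c d) =
    ∑ p ∈ Finset.range b, ∑ r ∈ Finset.range c, d p r := by
  rw [← gr_sum d b b c le_rfl]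
  exact Finset.sum_congr rfl fun k _ => bd_arr b c d b c k (by omega)

lemma RPP_finite (a b c : ℕ) : (RPP a b c).Finite := by
  have : Function.Injective (fun (π : RPP a b c) (p : Fin b × Fin c) =>
      (⟨π.1 p.1 p.2, Nat.lt_succ_of_le (π.2.2.2.2 _ _)⟩ : Fin (a + 1))) := by
    intro π π' h
    apply Subtype.ext
    funext i j
    by_cases hij : i < b ∧ j < c
    · have := congrFun h (⟨i, hij.1⟩, ⟨j, hij.2⟩)
      simpa using this
    · rw [π.2.1 i j (by omega), π'.2.1 i j (by omega)]
  exact Finite.of_injective _ this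

/-- cardinality of an up-set of `range c` -/
lemma upset_card (c : ℕ) (P : ℕ → Prop) [DecidablePred P]
    (hP : ∀ i j, i ≤ j → j < c → P i → P j) (j : ℕ) (hj : j < c) :
    c - j ≤ ((Finset.range c).filter P).card ↔ P j := by
  constructor
  · intro h
    by_contra hn
    have hsub : (Finset.range c).filter P ⊆ Finset.Ico (j + 1) c := by
      intro i hi
      simp only [Finset.mem_filter, Finset.mem_range, Finset.mem_Ico] at hi ⊢
      refine ⟨?_, hi.1⟩
      by_contra hlt
      exact hn (hP i j (by omega) hj hi.2)
    have := Finset.card_le_card hsub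
    rw [Nat.card_Ico] at this
    omega
  · intro h
    have hsub : Finset.Ico j c ⊆ (Finset.range c).filter P := by
      intro i hi
      simp only [Finset.mem_filter, Finset.mem_range, Finset.mem_Ico] at hi ⊢
      exact ⟨hi.2, hP j i hi.1 hi.2 h⟩
    have := Finset.card_le_card hsub
    rwa [Nat.card_Ico] at this

lemma mem_rect {a b i j : ℕ} : (i, j) ∈ rectDiagram a b ↔ i < b ∧ j < a := by
  rw [← YoungDiagram.mem_cells]
  simp [rectDiagram]

/-- Tableaux with entries less than `N`. -/
abbrev Tabs (a b N : ℕ) : Set (SemistandardYoungTableau (rectDiagram a b)) :=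
  {T | ∀ i j, (i, j) ∈ rectDiagram a b → T i j < N}

lemma tab_lower {a b : ℕ} (T : SemistandardYoungTableau (rectDiagram a b)) (k : ℕ) (hk : k < a) :
    ∀ i, i < b → i ≤ T i k := by
  intro i
  induction i with
  | zero => omega
  | succ i ih =>
    intro hi
    have h1 := ih (by omega)
    have := T.col_strict (Nat.lt_succ_self i) (mem_rect.2 ⟨hi, hk⟩)
    simp only [Nat.succ_eq_add_one] at this
    omega

lemma tab_upper {a b c : ℕ} (T : SemistandardYoungTableau (rectDiagram a b))
    (hT : T ∈ Tabs a b (b + c)) (k : ℕ) (hk : k < a) :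
    ∀ n i, i + n + 1 = b → T i k ≤ i + c := by
  intro n
  induction n with
  | zero =>
    intro i hi
    have := hT i k (mem_rect.2 ⟨by omega, hk⟩)
    omega
  | succ n ih =>
    intro i hi
    have h1 := ih (i + 1) (by omega)
    have := T.col_strict (Nat.lt_succ_self i) (mem_rect.2 ⟨by omega, hk⟩)
    simp only [Nat.succ_eq_add_one] at this
    omega

/-- The array of a tableau. -/
def tarr {a b : ℕ} (c : ℕ) (T : SemistandardYoungTableau (rectDiagram a b)) (i j : ℕ) : ℕ :=
  if i < b ∧ j < c then ((Finset.range a).filter fun k => i + c ≤ T i k + j).card else 0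

lemma tarr_mem {a b c : ℕ} (T : SemistandardYoungTableau (rectDiagram a b)) :
    tarr c T ∈ RPP a b c := by
  refine ⟨?_, ?_, ?_, ?_⟩
  · intro i j h; unfold tarr; rw [if_neg (by omega)]
  · intro i j hi hj
    unfold tarr
    rw [if_pos (by omega), if_pos (by omega)]
    apply Finset.card_le_card
    intro k hk
    simp only [Finset.mem_filter, Finset.mem_range] at hk ⊢
    have := T.col_strict (Nat.lt_succ_self i) (mem_rect.2 ⟨hi, hk.1⟩)
    simp only [Nat.succ_eq_add_one] at this
    exact ⟨hk.1, by omega⟩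
  · intro i j hi hj
    unfold tarr
    rw [if_pos (by omega), if_pos (by omega)]
    apply Finset.card_le_card
    intro k hk
    simp only [Finset.mem_filter, Finset.mem_range] at hk ⊢
    exact ⟨hk.1, by omega⟩
  · intro i j
    unfold tarr
    split_ifs
    · exact (Finset.card_filter_le _ _).trans (by simp)
    · omega

lemma tarr_inv {a b c : ℕ} (T : SemistandardYoungTableau (rectDiagram a b))
    (hT : T ∈ Tabs a b (b + c)) (i k : ℕ) (hi : i < b) (hk : k < a) :
    T i k = i + ((Finset.range c).filter fun j => a ≤ tarr c T i j + k).card := by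
  have hl := tab_lower T k hk i hi
  have hu := tab_upper T hT k hk (b - 1 - i) i (by omega)
  have e : ((Finset.range c).filter fun j => a ≤ tarr c T i j + k) = Finset.Ico (i + c - T i k) c := by
    ext j
    simp only [Finset.mem_filter, Finset.mem_range, Finset.mem_Ico]
    rw [and_comm (a := i + c - T i k ≤ j)]
    apply and_congr_right
    intro hj
    unfold tarr
    rw [if_pos (by omega)]
    have := upset_card a (fun k => i + c ≤ T i k + j) (by
      intro k1 k2 h12 h2 h
      have := T.row_weak_of_le h12 (mem_rect.2 ⟨hi, h2⟩)
      omega) k hk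
    omega
  rw [e, Nat.card_Ico]
  omega

/-- The tableau of an array. -/
def tabOf {a b c : ℕ} (π : ℕ → ℕ → ℕ) (h : π ∈ RPP a b c) :
    SemistandardYoungTableau (rectDiagram a b) where
  entry i k := if i < b ∧ k < a then
    i + ((Finset.range c).filter fun j => a ≤ π i j + k).card else 0
  row_weak' := by
    intro i k1 k2 h12 hm
    rw [mem_rect] at hm
    rw [if_pos (by omega), if_pos (by omega)]
    apply Nat.add_le_add_left
    apply Finset.card_le_card
    intro j hj
    simp only [Finset.mem_filter, Finset.mem_range] at hj ⊢
    exact ⟨hj.1, by omega⟩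
  col_strict' := by
    intro i1 i2 k h12 hm
    rw [mem_rect] at hm
    rw [if_pos (by omega), if_pos (by omega)]
    apply Nat.add_lt_add_of_lt_of_le h12
    apply Finset.card_le_card
    intro j hj
    simp only [Finset.mem_filter, Finset.mem_range] at hj ⊢
    refine ⟨hj.1, ?_⟩
    have : ∀ n, i1 + n < b → π i1 j ≤ π (i1 + n) j := by
      intro n
      induction n with
      | zero => intro _; rfl
      | succ n ih => intro hn; exact (ih (by omega)).trans (h.2.1 _ _ (by omega) hj.1)
    have := this (i2 - i1) (by omega)
    rw [show i1 + (i2 - i1) = i2 by omega] at this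
    omega
  zeros' := by
    intro i j hm
    rw [mem_rect] at hm
    rw [if_neg hm]

lemma tabOf_apply {a b c : ℕ} (π : ℕ → ℕ → ℕ) (h : π ∈ RPP a b c) (i k : ℕ) (hi : i < b)
    (hk : k < a) :
    tabOf π h i k = i + ((Finset.range c).filter fun j => a ≤ π i j + k).card := by
  change (if i < b ∧ k < a then _ else _) = _
  rw [if_pos ⟨hi, hk⟩]

lemma tabOf_mem {a b c : ℕ} (π : ℕ → ℕ → ℕ) (h : π ∈ RPP a b c) :
    tabOf π h ∈ Tabs a b (b + c) := by
  intro i k hm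
  rw [mem_rect] at hm
  rw [tabOf_apply π h i k hm.1 hm.2]
  have := Finset.card_filter_le (Finset.range c) fun j => a ≤ π i j + k
  rw [Finset.card_range] at this
  omega

lemma tarr_tabOf {a b c : ℕ} (π : ℕ → ℕ → ℕ) (h : π ∈ RPP a b c) : tarr c (tabOf π h) = π := by
  funext i j
  unfold tarr
  split_ifs with hij
  · have e : ((Finset.range a).filter fun k => i + c ≤ tabOf π h i k + j) =
        Finset.Ico (a - π i j) a := by
      ext k
      simp only [Finset.mem_filter, Finset.mem_range, Finset.mem_Ico]
      rw [and_comm (a := a - π i j ≤ k)]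
      apply and_congr_right
      intro hk
      rw [tabOf_apply π h i k hij.1 hk]
      have := upset_card c (fun j => a ≤ π i j + k) (by
        intro j1 j2 h12 h2 hh
        have : ∀ n, j1 + n < c → π i j1 ≤ π i (j1 + n) := by
          intro n
          induction n with
          | zero => intro _; rfl
          | succ n ih => intro hn; exact (ih (by omega)).trans (h.2.2.1 _ _ hij.1 (by omega))
        have := this (j2 - j1) (by omega)
        rw [show j1 + (j2 - j1) = j2 by omega] at this
        omega) j hij.2
      omega
    rw [e, Nat.card_Ico]
    have := h.2.2.2 i j
    omega
  · rw [h.1 i j (by omega)]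

lemma tab_weight {a b c : ℕ} (q : ℝ) (T : SemistandardYoungTableau (rectDiagram a b))
    (hT : T ∈ Tabs a b (b + c)) :
    ∏ p ∈ (rectDiagram a b).cells, oneExtend b (fun _ => q) (T p.1 p.2) =
      q ^ wt b c (tarr c T) := by
  have h1 : (rectDiagram a b).cells = Finset.range b ×ˢ Finset.range a := rfl
  rw [h1, Finset.prod_product]
  unfold wt
  rw [← Finset.prod_pow_eq_pow_sum, ← Finset.prod_range_reflect]
  apply Finset.prod_congr rfl
  intro i hi
  rw [Finset.mem_range] at hi
  simp only [oneExtend]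
  rw [Finset.prod_ite, Finset.prod_const_one, one_mul, Finset.prod_const]
  congr 1
  unfold bd
  split_ifs with hh
  · unfold tarr
    rw [if_pos (by omega)]
    rw [show b - 1 - i = b - 1 - i from rfl]
    congr 1
    apply Finset.filter_congr
    intro k hk
    omega
  · rw [Finset.card_eq_zero, Finset.filter_eq_empty_iff]
    intro k hk
    rw [Finset.mem_range] at hk
    have hu := tab_upper T hT k hk i (b - 1 - i) (by omega)
    omega

lemma geom_eq (q : ℝ) (b c : ℕ) (w : Fin b × Fin c → ℕ) :
    geomWeight q b c w = (1 - q) ^ (b * c) * q ^ wt b c (arr b c (matExt w)) := by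
  unfold geomWeight
  rw [Finset.prod_mul_distrib, Finset.prod_const, Finset.prod_pow_eq_pow_sum, wt_arr]
  congr 2
  · simp
  · rw [Fintype.sum_prod_type, ← Fin.sum_univ_eq_sum_range
      (fun p => ∑ r ∈ Finset.range c, matExt w p r) b]
    apply Finset.sum_congr rfl
    intro i _
    rw [← Fin.sum_univ_eq_sum_range (fun r => matExt w i r) c]
    apply Finset.sum_congr rfl
    intro j _
    simp [matExt]

lemma lp_iff {b c : ℕ} (hb : 0 < b) (hc : 0 < c) (d : ℕ → ℕ → ℕ) :
    lastPassage d (0, 0) (b - 1, c - 1) = gr d b c 0 := by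
  rw [lastPassage_eq, Nat.sub_add_cancel hb, Nat.sub_add_cancel hc]

end LPP

/-- for i.i.d. Geom(q) entries `w : Fin b × Fin c → ℕ` and the last passage
time `G(b,c)`, for every positive integer `a`,
`P(G(b,c) ≤ a) = (1−q)^{bc} s_{(a^b)}(1^b, q,…,q)`. -/
theorem lastPassage_cdf_schur (q : ℝ) (hq : q ∈ Set.Ioo (0 : ℝ) 1) (a b c : ℕ)
    (ha : 0 < a) (hb : 0 < b) (hc : 0 < c) :
    ∑' w : {w : Fin b × Fin c → ℕ //
        lastPassage (matExt w) (0, 0) (b - 1, c - 1) ≤ a},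
      geomWeight q b c w.1
    = (1 - q) ^ (b * c) * schur (rectDiagram a b) (b + c) (oneExtend b fun _ => q) := by
  classical
  let Φ : {w : Fin b × Fin c → ℕ // lastPassage (matExt w) (0, 0) (b - 1, c - 1) ≤ a} →
      LPP.RPP a b c :=
    fun w => ⟨LPP.arr b c (matExt w.1), LPP.arr_mem hb hc _ (by
      have := w.2
      rwa [LPP.lp_iff hb hc] at this)⟩
  have hΦ : Function.Bijective Φ := by
    constructor
    · intro w w' h
      have h' : LPP.arr b c (matExt w.1) = LPP.arr b c (matExt w'.1) := congrArg Subtype.val h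
      apply Subtype.ext
      funext p
      have := LPP.gr_inj b c _ _ h' p.1 p.2 p.1.2 p.2.2
      simpa [matExt] using this
    · rintro ⟨π, hπ⟩
      have e : LPP.arr b c (matExt fun p : Fin b × Fin c => LPP.bkw π b c p.1 p.2) = π := by
        apply LPP.arr_surj hπ
        intro i j hi hj
        simp [matExt, hi, hj]
      refine ⟨⟨fun p => LPP.bkw π b c p.1 p.2, ?_⟩, Subtype.ext e⟩
      rw [LPP.lp_iff hb hc, ← LPP.bd_arr b c _ b c 0 (by omega), e]
      unfold LPP.bd
      rw [if_pos ⟨hb, hc⟩]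
      exact hπ.2.2.2 _ _
  let Ψ : LPP.Tabs a b (b + c) → LPP.RPP a b c := fun T => ⟨LPP.tarr c T.1, LPP.tarr_mem T.1⟩
  have hΨ : Function.Bijective Ψ := by
    constructor
    · intro T T' h
      have h' : LPP.tarr c T.1 = LPP.tarr c T'.1 := congrArg Subtype.val h
      apply Subtype.ext
      apply SemistandardYoungTableau.ext
      intro i k
      by_cases hm : i < b ∧ k < a
      · rw [LPP.tarr_inv T.1 T.2 i k hm.1 hm.2, LPP.tarr_inv T'.1 T'.2 i k hm.1 hm.2, h']
      · rw [T.1.zeros (by rwa [LPP.mem_rect]), T'.1.zeros (by rwa [LPP.mem_rect])]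
    · rintro ⟨π, hπ⟩
      exact ⟨⟨LPP.tabOf π hπ, LPP.tabOf_mem π hπ⟩, Subtype.ext (LPP.tarr_tabOf π hπ)⟩
  have hfin : Finite (LPP.RPP a b c) := LPP.RPP_finite a b c
  have hfinw : Finite {w : Fin b × Fin c → ℕ //
      lastPassage (matExt w) (0, 0) (b - 1, c - 1) ≤ a} := Finite.of_injective Φ hΦ.1
  have hS : schur (rectDiagram a b) (b + c) (oneExtend b fun _ => q) =
      ∑ᶠ π : LPP.RPP a b c, q ^ LPP.wt b c π.1 := by
    unfold schur
    rw [← finsum_set_coe_eq_finsum_mem (LPP.Tabs a b (b + c))]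
    exact finsum_eq_of_bijective Ψ hΨ fun T => LPP.tab_weight q T.1 T.2
  rw [hS, mul_finsum' _ _ (Set.toFinite _), tsum_eq_finsum (Set.toFinite _)]
  exact finsum_eq_of_bijective Φ hΦ fun w => LPP.geom_eq q b c w.1
end
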